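/- arXiv:math/0606338 — 5 statements merged into one kernel-verified Lean document; each statement's English description precedes it below -/
import Mathlib

section
/- Let S be a Polish space and let (X_n) and (Y_n) be sequences of S-valued random variables such that the law of X_n is absolutely continuous with respect to the law of Y_n, with Radon–Nikodym density f_n, and such that X_n // Y_n → 1 (i.e. for every ε > 0, P(Y_n ∈ A_ε^n) → 1, where A_ε^n = {x ∈ S : |f_n(x) − 1| < ε}). If Y_n converges in distribution to a random variable Y, then X_n converges in distribution to Y. -/
open MeasureTheory Filter

/-- If `μ` has density `f` with respect to `ν`, then `μ B` falls short of `ν B` by at most `ε` plus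
the `ν`-mass of the set where `f` is not within `ε` of `1`. -/
lemma measureReal_le_add_of_density {S : Type*} [MeasurableSpace S] {μ ν : Measure S}
    [IsProbabilityMeasure μ] [IsProbabilityMeasure ν] {f : S → ℝ} (hf : Measurable f)
    (hdens : ∀ A : Set S, MeasurableSet A → μ.real A = ∫ x in A, f x ∂ν)
    {ε : ℝ} (hε : 0 ≤ ε) {B : Set S} (hB : MeasurableSet B) :
    ν.real B ≤ μ.real B + ε + (1 - ν.real {x | |f x - 1| < ε}) := by
  set A : Set S := {x | |f x - 1| < ε}
  have hA : MeasurableSet A := measurableSet_lt (hf.sub_const 1).abs measurable_const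
  have hint : Integrable f ν := by
    refine not_imp_comm.1 integral_undef ?_
    have h := hdens Set.univ MeasurableSet.univ
    rw [setIntegral_univ, probReal_univ] at h
    simp [← h]
  have hmono : μ.real (B ∩ A) ≤ μ.real B := measureReal_mono Set.inter_subset_left
  have hlow : (1 - ε) * ν.real (B ∩ A) ≤ μ.real (B ∩ A) := by
    rw [hdens _ (hB.inter hA)]
    refine setIntegral_ge_of_const_le_real (hB.inter hA) (measure_ne_top _ _) (fun x hx => ?_)
      hint.integrableOn
    have hx1 : |f x - 1| < ε := hx.2
    have := (abs_lt.1 hx1).1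
    linarith
  have hsplit : ν.real B ≤ ν.real (B ∩ A) + ν.real Aᶜ := by
    rw [← measureReal_inter_add_sdiff hA]
    exact add_le_add le_rfl (measureReal_mono fun x hx => hx.2)
  rw [probReal_compl_eq_one_sub hA] at hsplit
  have hone : ν.real (B ∩ A) ≤ 1 := measureReal_le_one
  nlinarith [mul_le_mul_of_nonneg_left hone hε]

/-- Let `S` be a Polish space and `(X n)`, `(Y n)` sequences of `S`-valued random
variables (identified with their laws, as probability measures on `S`) such that the
law of `X n` is absolutely continuous with respect to the law of `Y n`, with
Radon–Nikodym density `f n` (i.e. `P(X n ∈ A) = ∫_A f n dP_{Y n}` for every Borel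
set `A`), and such that `X n ∕∕ Y n → 1`, i.e. for every `ε > 0`,
`P(Y n ∈ {x | |f n x - 1| < ε}) → 1`.  If `Y n` converges in distribution to `Y`
(with law `L`), then `X n` converges in distribution to `Y`. -/
theorem statement0
    {S : Type*} [TopologicalSpace S] [PolishSpace S] [MeasurableSpace S] [BorelSpace S]
    (X Y : ℕ → ProbabilityMeasure S) (L : ProbabilityMeasure S)
    (f : ℕ → S → ℝ)
    (hf_meas : ∀ n, Measurable (f n))
    (hac : ∀ n, (X n : Measure S) ≪ (Y n : Measure S))
    (hdens : ∀ n, ∀ A : Set S, MeasurableSet A →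
      (((X n : Measure S) A).toReal = ∫ x in A, f n x ∂(Y n : Measure S)))
    (hratio : ∀ ε > (0 : ℝ),
      Tendsto (fun n => (((Y n : Measure S) {x | |f n x - 1| < ε}).toReal))
        atTop (nhds 1))
    (hY : Tendsto Y atTop (nhds L)) :
    Tendsto X atTop (nhds L) := by
  refine tendsto_of_forall_isOpen_le_liminf' fun G hG => ?_
  refine le_of_forall_lt fun c hc => ?_
  obtain ⟨c₁, hcc₁, hc₁⟩ := exists_between hc
  obtain ⟨c₂, hc₁₂, hc₂⟩ := exists_between hc₁
  refine hcc₁.trans_le (le_liminf_of_le (by isBoundedDefault) ?_)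
  have hc₂_top : c₂ ≠ ⊤ := hc₂.ne_top
  have hlt : c₁.toReal < c₂.toReal := ENNReal.toReal_strict_mono hc₂_top hc₁₂
  have hε : 0 < (c₂.toReal - c₁.toReal) / 2 := by linarith
  filter_upwards [eventually_lt_of_lt_liminf
      (hc₂.trans_le (ProbabilityMeasure.le_liminf_measure_open_of_tendsto hY hG)),
    (hratio _ hε).eventually (lt_mem_nhds (sub_lt_self 1 hε))] with n hYn hAn
  have hYn' := ENNReal.toReal_strict_mono (measure_ne_top _ _) hYn
  have hle := measureReal_le_add_of_density (hf_meas n) (hdens n) hε.le hG.measurableSet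
  simp only [Measure.real] at hle
  rw [← ENNReal.toReal_le_toReal hc₁₂.ne_top (measure_ne_top _ _)]
  linarith
end

section
/- Let S be a Polish space and let (X_n) and (Y_n) be sequences of S-valued random variables such that the law of X_n is absolutely continuous with respect to the law of Y_n, with Radon–Nikodym density f_n, and such that X_n // Y_n → 1. Then the total variation distance sup over Borel sets B of |P(X_n ∈ B) − P(Y_n ∈ B)| tends to 0 as n → ∞. -/
open MeasureTheory Filter

/-- If `μ` has density `f` with respect to `ν`, then `ν B` exceeds `μ B` by at most `ε` plus the
`ν`-mass of the set where `f` is not within `ε` of `1`. -/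
lemma measureReal_sub_le_of_density {S : Type*} [MeasurableSpace S]
    {μ ν : Measure S} [IsProbabilityMeasure μ] [IsProbabilityMeasure ν]
    {f : S → ℝ} (hf : Measurable f)
    (hdens : ∀ A : Set S, MeasurableSet A → μ.real A = ∫ x in A, f x ∂ν)
    {ε : ℝ} (hε : 0 < ε) {B : Set S} (hB : MeasurableSet B) :
    ν.real B - μ.real B ≤ ε + (1 - ν.real {x | |f x - 1| < ε}) := by
  set A : Set S := {x | |f x - 1| < ε}
  have hA : MeasurableSet A := measurableSet_lt (by fun_prop) measurable_const
  have hint : Integrable f ν := by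
    by_contra h
    have huniv := hdens Set.univ MeasurableSet.univ
    rw [setIntegral_univ, integral_undef h, probReal_univ] at huniv
    exact one_ne_zero huniv
  have hlow : (1 - ε) * ν.real (B ∩ A) ≤ μ.real (B ∩ A) := by
    rw [hdens _ (hB.inter hA)]
    refine setIntegral_ge_of_const_le_real (hB.inter hA) (measure_ne_top _ _) (fun x hx => ?_)
      hint.integrableOn
    linarith [(abs_lt.mp (show |f x - 1| < ε from hx.2)).1]
  have hmono : μ.real (B ∩ A) ≤ μ.real B := measureReal_mono Set.inter_subset_left
  have hsplit : ν.real (B ∩ A) + ν.real (B \ A) = ν.real B := measureReal_inter_add_sdiff hA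
  have hdiff : ν.real (B \ A) ≤ ν.real Aᶜ := measureReal_mono fun x hx => hx.2
  rw [probReal_compl_eq_one_sub hA] at hdiff
  have hle : ε * ν.real (B ∩ A) ≤ ε := mul_le_of_le_one_right hε.le measureReal_le_one
  linarith

/-- Two-sided version of `measureReal_sub_le_of_density`. -/
lemma abs_measureReal_sub_le_of_density {S : Type*} [MeasurableSpace S]
    {μ ν : Measure S} [IsProbabilityMeasure μ] [IsProbabilityMeasure ν]
    {f : S → ℝ} (hf : Measurable f)
    (hdens : ∀ A : Set S, MeasurableSet A → μ.real A = ∫ x in A, f x ∂ν)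
    {ε : ℝ} (hε : 0 < ε) {B : Set S} (hB : MeasurableSet B) :
    |μ.real B - ν.real B| ≤ ε + (1 - ν.real {x | |f x - 1| < ε}) := by
  have h := measureReal_sub_le_of_density hf hdens hε hB
  have hc := measureReal_sub_le_of_density hf hdens hε hB.compl
  rw [probReal_compl_eq_one_sub hB, probReal_compl_eq_one_sub hB] at hc
  exact abs_le.mpr ⟨by linarith, by linarith⟩

/-- Let `S` be a Polish space and `(X n)`, `(Y n)` sequences of `S`-valued random
variables (identified with their laws, as probability measures on `S`) such that the
law of `X n` is absolutely continuous with respect to the law of `Y n`, with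
Radon–Nikodym density `f n` (i.e. `P(X n ∈ A) = ∫_A f n dP_{Y n}` for every Borel
set `A`), and such that `X n ∕∕ Y n → 1`, i.e. for every `ε > 0`,
`P(Y n ∈ {x | |f n x - 1| < ε}) → 1`.  Then the total variation distance
`sup_{B Borel} |P(X n ∈ B) - P(Y n ∈ B)|` tends to `0` as `n → ∞`. -/
theorem statement1
    {S : Type*} [TopologicalSpace S] [PolishSpace S] [MeasurableSpace S] [BorelSpace S]
    (X Y : ℕ → ProbabilityMeasure S)
    (f : ℕ → S → ℝ)
    (hf_meas : ∀ n, Measurable (f n))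
    (hac : ∀ n, (X n : Measure S) ≪ (Y n : Measure S))
    (hdens : ∀ n, ∀ A : Set S, MeasurableSet A →
      (((X n : Measure S) A).toReal = ∫ x in A, f n x ∂(Y n : Measure S)))
    (hratio : ∀ ε > (0 : ℝ),
      Tendsto (fun n => (((Y n : Measure S) {x | |f n x - 1| < ε}).toReal))
        atTop (nhds 1)) :
    Tendsto
      (fun n => ⨆ B : {B : Set S // MeasurableSet B},
        |((X n : Measure S) B.val).toReal - ((Y n : Measure S) B.val).toReal|)
      atTop (nhds 0) := by
  rw [Metric.tendsto_atTop']
  intro ε hε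
  obtain ⟨N, hN⟩ := Metric.tendsto_atTop'.mp (hratio (ε / 2) (half_pos hε)) (ε / 2) (half_pos hε)
  refine ⟨N, fun n hn => ?_⟩
  have hclose := hN n hn
  rw [Real.dist_eq] at hclose
  have : Nonempty {B : Set S // MeasurableSet B} := ⟨⟨∅, MeasurableSet.empty⟩⟩
  have hsup := ciSup_le fun B : {B : Set S // MeasurableSet B} =>
    abs_measureReal_sub_le_of_density (hf_meas n) (hdens n) (half_pos hε) B.2
  simp only [measureReal_def] at hsup
  rw [Real.dist_0_eq_abs, abs_of_nonneg (Real.iSup_nonneg fun _ => abs_nonneg _)]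
  refine hsup.trans_lt ?_
  linarith [(abs_lt.mp hclose).1]
end

section
/- Assume (H1). Then sup over n ≥ 0 and over integers x ≥ 0 of x · P(W_n = x) is finite. -/
open scoped Classical
open Filter
noncomputable section

/-- A planar tree: a finite set of words on `{1,2,...}` containing the root `[]`,
closed under taking fathers and elder brothers. -/
def IsPlanarTree (T : Finset (List ℕ)) : Prop :=
  [] ∈ T ∧ ∀ (u : List ℕ) (i : ℕ), u ++ [i] ∈ T →
    1 ≤ i ∧ u ∈ T ∧ ∀ j, 1 ≤ j → j ≤ i → u ++ [j] ∈ T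

/-- The type of planar trees. -/
def PlanarTree := {T : Finset (List ℕ) // IsPlanarTree T}

/-- Number of children of the vertex `u` in `T`. -/
def numChildren (T : Finset (List ℕ)) (u : List ℕ) : ℕ :=
  (T.filter fun v => ∃ i, v = u ++ [i]).card

/-- Galton-Watson weight of a tree: product over the vertices of `μ (number of children)`. -/
def gwWeight (μ : ℕ → ℝ) (T : Finset (List ℕ)) : ℝ :=
  ∏ u ∈ T, μ (numChildren T u)

/-- Probability of a set of planar trees under the Galton-Watson measure. -/
def gwProb (μ : ℕ → ℝ) (S : Set PlanarTree) : ℝ :=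
  ∑' T : S, gwWeight μ (T : PlanarTree).val

/-- `P(|T| = n)` : probability that the total progeny has `n` vertices. -/
def treeSizeProb (μ : ℕ → ℝ) (n : ℕ) : ℝ :=
  gwProb μ {T | T.val.card = n}

/-- Hypothesis (H1): `μ` is a probability distribution on ℕ, non-degenerate
(`μ 0 + μ 1 ≠ 1`), critical (mean 1), with support bounded by `K > 0`. -/
def H1 (μ : ℕ → ℝ) (K : ℕ) : Prop :=
  (∀ k, 0 ≤ μ k) ∧ HasSum μ 1 ∧ μ 0 + μ 1 ≠ 1 ∧
    HasSum (fun k : ℕ => (k : ℝ) * μ k) 1 ∧ 0 < K ∧ ∀ k, K < k → μ k = 0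

/-- Law of the random walk `W` started at 0 with i.i.d. increments distributed as
`ξ - 1`, `ξ ∼ μ` : `walkProb μ n x = P(W_n = x)`. -/
def walkProb (μ : ℕ → ℝ) : ℕ → ℤ → ℝ
  | 0, x => if x = 0 then 1 else 0
  | n + 1, x => ∑' k : ℕ, μ k * walkProb μ n (x - ((k : ℤ) - 1))

section LocalLimitBounds

open Polynomial

theorem Nat.succ_mul_sq_centralBinom_le (n : ℕ) :
    (2 * n + 1) * n.centralBinom ^ 2 ≤ 16 ^ n := by
  induction n with
  | zero => simp
  | succ n ih =>
    have h := Nat.succ_mul_centralBinom_succ n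
    have hpos : 0 < (n + 1) ^ 2 := by positivity
    refine Nat.le_of_mul_le_mul_left ?_ hpos
    calc (n + 1) ^ 2 * ((2 * (n + 1) + 1) * (n + 1).centralBinom ^ 2)
        = (2 * n + 3) * ((n + 1) * (n + 1).centralBinom) ^ 2 := by ring
      _ = (4 * (2 * n + 3) * (2 * n + 1)) * ((2 * n + 1) * n.centralBinom ^ 2) := by
          rw [h]; ring
      _ ≤ (16 * (n + 1) ^ 2) * 16 ^ n := by
          refine Nat.mul_le_mul ?_ ih
          nlinarith
      _ = (n + 1) ^ 2 * 16 ^ (n + 1) := by ring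

theorem Nat.succ_mul_sq_choose_half_le (j : ℕ) :
    (j + 1) * (j.choose (j / 2)) ^ 2 ≤ 4 ^ j := by
  rcases Nat.even_or_odd' j with ⟨n, rfl | rfl⟩
  · have h := Nat.succ_mul_sq_centralBinom_le n
    rw [Nat.centralBinom_eq_two_mul_choose] at h
    rw [Nat.mul_div_cancel_left _ two_pos, pow_mul]
    exact h
  · have h := Nat.succ_mul_sq_centralBinom_le (n + 1)
    have hc : (n + 1).centralBinom = 2 * (2 * n + 1).choose n := by
      rw [Nat.centralBinom_eq_two_mul_choose, show 2 * (n + 1) = (2 * n + 1) + 1 by ring,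
        Nat.choose_succ_succ, Nat.choose_symm_half]
      ring
    rw [hc] at h
    have hd : (2 * n + 1) / 2 = n := by omega
    rw [hd]
    have e : (4 : ℕ) ^ (2 * n + 1) = 4 * 16 ^ n := by
      rw [pow_succ, pow_mul]; norm_num; ring
    rw [e]
    rw [pow_succ 16] at h
    nlinarith [Nat.zero_le ((2 * n + 1).choose n ^ 2)]

theorem Nat.choose_le_two_pow_div_sqrt (j i : ℕ) :
    (j.choose i : ℝ) ≤ 2 ^ j / √(j + 1) := by
  have h1 : (j.choose i : ℝ) ≤ j.choose (j / 2) := by exact_mod_cast Nat.choose_le_middle i j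
  have h2 : ((j : ℝ) + 1) * (j.choose (j / 2) : ℝ) ^ 2 ≤ 4 ^ j := by
    exact_mod_cast Nat.succ_mul_sq_choose_half_le j
  refine h1.trans ?_
  rw [le_div_iff₀ (by positivity)]
  refine abs_le_of_sq_le_sq' ?_ (by positivity) |>.2
  rw [mul_pow, Real.sq_sqrt (by positivity), ← pow_mul, mul_comm j 2, pow_mul]
  norm_num
  linarith

theorem sum_choose_mul_div_succ_le {p q : ℝ} (hp : 0 < p) (hq : 0 ≤ q) (hpq : p + q = 1) (n : ℕ) :
    ∑ j ∈ Finset.range (n + 1), p ^ j * q ^ (n - j) * n.choose j / (j + 1) ≤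
      1 / (p * (n + 1)) := by
  have h := add_pow p q (n + 1)
  rw [hpq, one_pow, Finset.sum_range_succ'] at h
  have h0 : 0 ≤ p ^ 0 * q ^ (n + 1 - 0) * ((n + 1).choose 0 : ℝ) := by positivity
  rw [le_div_iff₀ (by positivity), Finset.sum_mul]
  refine le_of_eq_of_le ?_ (le_of_add_le_of_nonneg_left h.ge h0)
  refine Finset.sum_congr rfl fun j _ => ?_
  have hc : ((n : ℝ) + 1) * n.choose j = (n + 1).choose (j + 1) * (j + 1) := by
    exact_mod_cast Nat.add_one_mul_choose_eq n j
  rw [Nat.add_sub_add_right, div_mul_eq_mul_div, div_eq_iff (by positivity)]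
  calc _ = p ^ (j + 1) * q ^ (n - j) * (((n : ℝ) + 1) * n.choose j) := by ring
    _ = _ := by rw [hc]; ring

theorem inv_sqrt_le_half_add {s y : ℝ} (hs : 0 < s) (hy : 0 < y) :
    1 / √y ≤ (1 / s + s / y) / 2 := by
  have h : 0 < √y := Real.sqrt_pos.2 hy
  have e : y = √y ^ 2 := (Real.sq_sqrt hy.le).symm
  have : (1 / s + s / y) / 2 - 1 / √y = (√y - s) ^ 2 / (2 * s * √y ^ 2) := by
    rw [← e]
    nth_rewrite 1 [e]
    rw [e, Real.sqrt_sq h.le]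
    field_simp
    ring
  have h' : 0 ≤ (√y - s) ^ 2 / (2 * s * √y ^ 2) := by positivity
  linarith

theorem sum_binomial_div_sqrt_le {p q : ℝ} (hp : 0 < p) (hq : 0 ≤ q) (hpq : p + q = 1) (n : ℕ) :
    ∑ j ∈ Finset.range (n + 1), p ^ j * q ^ (n - j) * n.choose j * (1 / √(j + 1)) ≤
      (1 + 1 / p) / √(n + 1) := by
  set s : ℝ := √(n + 1) with hs
  have hs0 : 0 < s := by positivity
  have hs2 : s ^ 2 = n + 1 := Real.sq_sqrt (by positivity)
  have h1 := add_pow p q n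
  rw [hpq, one_pow] at h1
  have h2 := sum_choose_mul_div_succ_le hp hq hpq n
  calc _ ≤ ∑ j ∈ Finset.range (n + 1), (p ^ j * q ^ (n - j) * n.choose j * (1 / (2 * s)) +
        p ^ j * q ^ (n - j) * n.choose j / (j + 1) * (s / 2)) := by
        refine Finset.sum_le_sum fun j _ => ?_
        have := inv_sqrt_le_half_add hs0 (show (0 : ℝ) < j + 1 by positivity)
        calc _ ≤ p ^ j * q ^ (n - j) * n.choose j * ((1 / s + s / (j + 1)) / 2) :=
              mul_le_mul_of_nonneg_left this (by positivity)
          _ = _ := by field_simp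
    _ = 1 / (2 * s) + (∑ j ∈ Finset.range (n + 1),
          p ^ j * q ^ (n - j) * n.choose j / (j + 1)) * (s / 2) := by
        rw [Finset.sum_add_distrib, ← Finset.sum_mul, ← Finset.sum_mul, ← h1, one_mul]
    _ ≤ 1 / (2 * s) + 1 / (p * (n + 1)) * (s / 2) := by gcongr
    _ = (1 + 1 / p) / s / 2 := by
        rw [← hs2]; field_simp
    _ ≤ _ := by
        have : 0 ≤ (1 + 1 / p) / s := by positivity
        linarith

namespace Polynomial

theorem coeff_mul_nonneg {P R : ℝ[X]} (hP : ∀ i, 0 ≤ P.coeff i) (hR : ∀ i, 0 ≤ R.coeff i) (i : ℕ) :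
    0 ≤ (P * R).coeff i := by
  rw [coeff_mul]
  exact Finset.sum_nonneg fun x _ => mul_nonneg (hP _) (hR _)

theorem coeff_pow_nonneg {P : ℝ[X]} (hP : ∀ i, 0 ≤ P.coeff i) (n i : ℕ) :
    0 ≤ (P ^ n).coeff i := by
  induction n generalizing i with
  | zero => rw [pow_zero, coeff_one]; split_ifs <;> norm_num
  | succ n ih => rw [pow_succ]; exact coeff_mul_nonneg ih hP i

theorem sum_range_le_sum {P : ℝ[X]} (hP : ∀ i, 0 ≤ P.coeff i) {w : ℕ → ℝ} (hw : ∀ i, 0 ≤ w i)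
    (N : ℕ) : ∑ i ∈ Finset.range N, P.coeff i * w i ≤ P.sum fun i c => c * w i := by
  rw [P.sum_over_range' (by simp) (max N (P.natDegree + 1)) (by simp)]
  exact Finset.sum_le_sum_of_subset_of_nonneg (Finset.range_mono (le_max_left _ _))
    fun i _ _ => mul_nonneg (hP i) (hw i)

theorem sum_antidiagonal_mul_le {P R : ℝ[X]} (hP : ∀ i, 0 ≤ P.coeff i)
    {w : ℕ → ℝ} (hw : ∀ i, 0 ≤ w i) {B : ℝ} (hB : 0 ≤ B) (hR : ∀ i, R.coeff i ≤ B) (N : ℕ) :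
    ∑ x ∈ Finset.HasAntidiagonal.antidiagonal N, P.coeff x.1 * w x.1 * R.coeff x.2 ≤
      (P.sum fun i c => c * w i) * B := by
  calc _ ≤ ∑ x ∈ Finset.HasAntidiagonal.antidiagonal N, P.coeff x.1 * w x.1 * B :=
        Finset.sum_le_sum fun x _ =>
          mul_le_mul_of_nonneg_left (hR _) (mul_nonneg (hP _) (hw _))
    _ = (∑ i ∈ Finset.range (N + 1), P.coeff i * w i) * B := by
        rw [Finset.Nat.sum_antidiagonal_eq_sum_range_succ_mk, Finset.sum_mul]
    _ ≤ _ := mul_le_mul_of_nonneg_right (sum_range_le_sum hP hw _) hB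

theorem coeff_one_add_X_pow_pow_le {k : ℕ} (hk : 0 < k) (j i : ℕ) :
    ((1 + X ^ k : ℝ[X]) ^ j).coeff i ≤ 2 ^ j / √(j + 1) := by
  have : (1 + X ^ k : ℝ[X]) ^ j = expand ℝ k ((1 + X) ^ j) := by simp
  rw [this, coeff_expand hk]
  split_ifs
  · rw [coeff_one_add_X_pow]
    exact Nat.choose_le_two_pow_div_sqrt _ _
  · positivity

theorem coeff_mul_le {P R : ℝ[X]} (hP : ∀ i, 0 ≤ P.coeff i)
    {B : ℝ} (hB : 0 ≤ B) (hR : ∀ i, R.coeff i ≤ B) (i : ℕ) :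
    (P * R).coeff i ≤ P.eval 1 * B := by
  rw [coeff_mul]
  have h := sum_antidiagonal_mul_le hP (w := fun _ => 1) (fun _ => zero_le_one) hB hR i
  simpa [eval_eq_sum] using h

/-- Powers of a probability generating function charging both `0` and `k > 0` have coefficients
of order `1 / √n`. -/
theorem coeff_pow_le_div_sqrt {R : ℝ[X]} {a : ℝ} {k : ℕ} (hk : 0 < k) (ha : 0 < a)
    (hR : ∀ i, 0 ≤ R.coeff i) (hsum : 2 * a + R.eval 1 = 1) (n i : ℕ) :
    ((C a * (1 + X ^ k) + R) ^ n).coeff i ≤ (1 + 1 / (2 * a)) / √(n + 1) := by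
  have hR1 : 0 ≤ R.eval 1 := by
    rw [eval_eq_sum]
    exact Finset.sum_nonneg fun i _ => by simpa using hR i
  refine le_trans ?_ (sum_binomial_div_sqrt_le (by positivity : 0 < 2 * a) hR1 hsum n)
  rw [add_pow, finsetSum_coeff]
  refine Finset.sum_le_sum fun j _ => ?_
  have h := coeff_mul_le (coeff_pow_nonneg hR (n - j)) (by positivity)
    (coeff_one_add_X_pow_pow_le hk j) i
  rw [eval_pow] at h
  have e : (C a * (1 + X ^ k)) ^ j * R ^ (n - j) * (n.choose j : ℝ[X]) =
      C (a ^ j * n.choose j) * (R ^ (n - j) * (1 + X ^ k) ^ j) := by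
    rw [mul_pow, C_mul, C_pow]; simp only [map_natCast]; ring
  rw [e, coeff_C_mul]
  calc _ ≤ a ^ j * n.choose j * (eval 1 R ^ (n - j) * (2 ^ j / √(j + 1))) :=
        mul_le_mul_of_nonneg_left h (by positivity)
    _ = _ := by rw [mul_pow]; ring

theorem sum_mul_sq_sub (P : ℝ[X]) (a : ℝ) :
    (P.sum fun i c => c * ((i : ℝ) - a) ^ 2) =
      (derivative (derivative P)).eval 1 + (1 - 2 * a) * (derivative P).eval 1 +
        a ^ 2 * P.eval 1 := by
  induction P using Polynomial.induction_on' with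
  | add p q hp hq =>
    rw [sum_add_index _ _ _ (by simp) (by intros; ring), hp, hq]
    simp only [derivative_add, eval_add]
    ring
  | monomial n c =>
    rw [sum_monomial_index _ _ (by simp)]
    rcases n with _ | _ | n <;> simp <;> ring

theorem sum_pow_mul_sq_sub {Q : ℝ[X]} (h0 : Q.eval 1 = 1) (h1 : (derivative Q).eval 1 = 1)
    (n : ℕ) : ((Q ^ n).sum fun i c => c * ((i : ℝ) - n) ^ 2) =
      n * (derivative (derivative Q)).eval 1 := by
  rw [sum_mul_sq_sub]
  rcases n with _ | n
  · simp
  · simp [derivative_pow, h0, h1]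
    rcases n with _ | n <;> simp <;> ring

/-- First absolute moment of the fluctuations of a sum of critical variables. -/
theorem sum_pow_mul_abs_sub_le {Q : ℝ[X]} (hQ : ∀ i, 0 ≤ Q.coeff i) (h0 : Q.eval 1 = 1)
    (h1 : (derivative Q).eval 1 = 1) (n : ℕ) :
    ((Q ^ n).sum fun i c => c * |(i : ℝ) - n|) ≤
      (1 + |(derivative (derivative Q)).eval 1|) * √(n + 1) := by
  set s : ℝ := √(n + 1) with hs
  set v := (derivative (derivative Q)).eval 1
  have hs0 : 0 < s := by positivity
  have hs2 : s ^ 2 = n + 1 := Real.sq_sqrt (by positivity)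
  have hv := sum_pow_mul_sq_sub h0 h1 n
  have hone : ((Q ^ n).sum fun _ c => c) = 1 := by
    have : (Q ^ n).eval 1 = 1 := by simp [h0]
    simpa [eval_eq_sum] using this
  rw [sum_def] at hv hone ⊢
  calc _ ≤ ∑ i ∈ (Q ^ n).support, ((Q ^ n).coeff i * s +
        (Q ^ n).coeff i * ((i : ℝ) - n) ^ 2 * (1 / s)) := by
        refine Finset.sum_le_sum fun i _ => ?_
        rw [mul_assoc, ← mul_add]
        refine mul_le_mul_of_nonneg_left ?_ (coeff_pow_nonneg hQ n i)
        rw [← sq_abs ((i : ℝ) - n), mul_one_div, ← sub_le_iff_le_add', le_div_iff₀ hs0]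
        nlinarith [sq_nonneg (|(i : ℝ) - n| - s), abs_nonneg ((i : ℝ) - n)]
    _ = s + n * v * (1 / s) := by
        rw [Finset.sum_add_distrib, ← Finset.sum_mul, ← Finset.sum_mul, hv, hone, one_mul]
    _ ≤ s + s ^ 2 * |v| * (1 / s) := by
        gcongr s + ?_ * (1 / s)
        rw [hs2]
        nlinarith [le_abs_self v, abs_nonneg v, (Nat.cast_nonneg n : (0 : ℝ) ≤ n)]
    _ = (1 + |v|) * s := by field_simp

theorem mul_coeff_mul_le {P R : ℝ[X]} (hP : ∀ i, 0 ≤ P.coeff i) (hR : ∀ i, 0 ≤ R.coeff i)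
    {A B : ℝ} (hA : ∀ i, P.coeff i ≤ A) (hB : ∀ i, R.coeff i ≤ B) (a b x : ℕ) :
    (x : ℝ) * (P * R).coeff (x + (a + b)) ≤
      (P.sum fun i c => c * |(i : ℝ) - a|) * B + (R.sum fun i c => c * |(i : ℝ) - b|) * A := by
  have hP' := sum_antidiagonal_mul_le hP (w := fun i => |(i : ℝ) - a|) (fun _ => abs_nonneg _)
    ((hR 0).trans (hB 0)) hB (x + (a + b))
  have hR' := sum_antidiagonal_mul_le hR (w := fun i => |(i : ℝ) - b|) (fun _ => abs_nonneg _)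
    ((hP 0).trans (hA 0)) hA (x + (a + b))
  rw [← Finset.Nat.sum_antidiagonal_swap] at hR'
  refine le_trans ?_ (add_le_add hP' hR')
  rw [coeff_mul, Finset.mul_sum, ← Finset.sum_add_distrib]
  refine Finset.sum_le_sum fun y hy => ?_
  have hy' : (y.1 : ℝ) + y.2 = x + (a + b) := by
    exact_mod_cast Finset.HasAntidiagonal.mem_antidiagonal.1 hy
  have hx : (x : ℝ) ≤ |(y.1 : ℝ) - a| + |(y.2 : ℝ) - b| := by
    have := le_abs_self ((y.1 : ℝ) - a)
    have := le_abs_self ((y.2 : ℝ) - b)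
    linarith
  calc _ ≤ (|(y.1 : ℝ) - a| + |(y.2 : ℝ) - b|) * (P.coeff y.1 * R.coeff y.2) :=
        mul_le_mul_of_nonneg_right hx (mul_nonneg (hP _) (hR _))
    _ = _ := by simp only [Prod.fst_swap, Prod.snd_swap]; ring

theorem mul_coeff_pow_le {Q : ℝ[X]} (hQ : ∀ i, 0 ≤ Q.coeff i) {D M : ℝ} (hD : 0 ≤ D) (hM : 0 ≤ M)
    (hcoeff : ∀ n i : ℕ, (Q ^ n).coeff i ≤ D / √(n + 1))
    (hmoment : ∀ n : ℕ, ((Q ^ n).sum fun i c => c * |(i : ℝ) - n|) ≤ M * √(n + 1)) (n x : ℕ) :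
    (x : ℝ) * (Q ^ n).coeff (x + n) ≤ 3 * (M * D) := by
  obtain ⟨a, b, rfl, hab, hba⟩ : ∃ a b : ℕ, n = a + b ∧ a ≤ b ∧ b ≤ a + 1 :=
    ⟨n / 2, n - n / 2, by omega, by omega, by omega⟩
  have h := mul_coeff_mul_le (coeff_pow_nonneg hQ a) (coeff_pow_nonneg hQ b) (hcoeff a)
    (hcoeff b) a b x
  rw [← pow_add] at h
  have ha : √((a : ℝ) + 1) ≤ √(b + 1) := Real.sqrt_le_sqrt (by gcongr)
  have hb : √((b : ℝ) + 1) ≤ 2 * √(a + 1) := by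
    have : (b : ℝ) ≤ a + 1 := by exact_mod_cast hba
    refine Real.sqrt_le_iff.2 ⟨by positivity, ?_⟩
    rw [mul_pow, Real.sq_sqrt (by positivity)]
    linarith [(Nat.cast_nonneg a : (0 : ℝ) ≤ a)]
  refine h.trans ?_
  have e1 : M * √((a : ℝ) + 1) * (D / √(b + 1)) ≤ M * D := by
    rw [mul_div_assoc', div_le_iff₀ (by positivity)]
    nlinarith [mul_le_mul_of_nonneg_left ha (mul_nonneg hM hD)]
  have e2 : M * √((b : ℝ) + 1) * (D / √(a + 1)) ≤ 2 * (M * D) := by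
    rw [mul_div_assoc', div_le_iff₀ (by positivity)]
    nlinarith [mul_le_mul_of_nonneg_left hb (mul_nonneg hM hD)]
  have f1 := mul_le_mul_of_nonneg_right (hmoment a) (show 0 ≤ D / √((b : ℝ) + 1) by positivity)
  have f2 := mul_le_mul_of_nonneg_right (hmoment b) (show 0 ≤ D / √((a : ℝ) + 1) by positivity)
  linarith

end Polynomial

/-- The generating polynomial of a law supported in `{0, ..., K}`. -/
def genPoly (μ : ℕ → ℝ) (K : ℕ) : ℝ[X] := ∑ k ∈ Finset.range (K + 1), monomial k (μ k)

theorem genPoly_coeff {μ : ℕ → ℝ} {K : ℕ} (hK : ∀ k, K < k → μ k = 0) (i : ℕ) :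
    (genPoly μ K).coeff i = μ i := by
  simp only [genPoly, finsetSum_coeff, coeff_monomial, Finset.sum_ite_eq', Finset.mem_range]
  split_ifs with h
  · rfl
  · exact (hK i (by omega)).symm

theorem walkProb_eq_coeff {μ : ℕ → ℝ} {K : ℕ} (hK : ∀ k, K < k → μ k = 0) (n : ℕ) (x : ℤ) :
    walkProb μ n x = if 0 ≤ x + n then (genPoly μ K ^ n).coeff (x + n).toNat else 0 := by
  induction n generalizing x with
  | zero =>
    simp only [walkProb, pow_zero, coeff_one, Nat.cast_zero, add_zero]
    split_ifs <;> first | rfl | omega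
  | succ n ih =>
    rw [walkProb, tsum_eq_sum (s := Finset.range ((x + (n + 1 : ℕ)).toNat + 1))]
    · split_ifs with hx
      · rw [pow_succ', coeff_mul, Finset.Nat.sum_antidiagonal_eq_sum_range_succ_mk]
        refine Finset.sum_congr rfl fun k hk => ?_
        rw [Finset.mem_range] at hk
        rw [ih, if_pos (by omega), genPoly_coeff hK]
        congr 2
        omega
      · refine Finset.sum_eq_zero fun k _ => ?_
        rw [ih, if_neg (by omega), mul_zero]
    · intro k hk
      rw [Finset.mem_range] at hk
      rw [ih, if_neg (by omega), mul_zero]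

namespace H1

variable {μ : ℕ → ℝ} {K : ℕ}

theorem exists_two_le_pos (h : H1 μ K) : ∃ k, 2 ≤ k ∧ 0 < μ k := by
  obtain ⟨hnn, hsum, hne, -⟩ := h
  by_contra! hcon
  refine hne (HasSum.unique ?_ hsum)
  have := hasSum_sum_of_ne_finset_zero (L := .unconditional ℕ) (f := μ) (s := Finset.range 2) fun k hk =>
    le_antisymm (hcon k (not_lt.1 (Finset.mem_range.not.1 hk))) (hnn k)
  simpa [Finset.sum_range_succ] using this

theorem zero_pos (h : H1 μ K) : 0 < μ 0 := by
  obtain ⟨k, hk, hμk⟩ := h.exists_two_le_pos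
  obtain ⟨hnn, hsum, -, hmean, -⟩ := h
  refine (hnn 0).lt_of_ne fun h0 => ?_
  have hk' : (2 : ℝ) ≤ k := by exact_mod_cast hk
  have hd := hmean.sub hsum
  rw [sub_self] at hd
  have hnn' : ∀ i : ℕ, 0 ≤ (i : ℝ) * μ i - μ i := fun i => by
    rcases i with _ | i
    · simp [← h0]
    · push_cast
      have := mul_nonneg (Nat.cast_nonneg (α := ℝ) i) (hnn (i + 1))
      linarith
  have := le_hasSum hd k fun i _ => hnn' i
  nlinarith

theorem genPoly_eval_one (h : H1 μ K) : (genPoly μ K).eval 1 = 1 := by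
  obtain ⟨-, hsum, -, -, -, hK⟩ := h
  have := hasSum_sum_of_ne_finset_zero (L := .unconditional ℕ) (f := μ) (s := Finset.range (K + 1)) fun k hk =>
    hK k (not_lt.1 (Finset.mem_range.not.1 hk))
  simpa [genPoly, eval_finsetSum] using this.unique hsum

theorem derivative_genPoly_eval_one (h : H1 μ K) : (derivative (genPoly μ K)).eval 1 = 1 := by
  obtain ⟨-, -, -, hmean, -, hK⟩ := h
  have := hasSum_sum_of_ne_finset_zero (L := .unconditional ℕ) (f := fun k : ℕ => (k : ℝ) * μ k)
    (s := Finset.range (K + 1)) fun k hk => by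
      rw [hK k (not_lt.1 (Finset.mem_range.not.1 hk)), mul_zero]
  simpa [genPoly, eval_finsetSum, derivative_monomial, mul_comm] using this.unique hmean

theorem exists_coeff_genPoly_pow_le (h : H1 μ K) :
    ∃ D : ℝ, 0 ≤ D ∧ ∀ n i : ℕ, (genPoly μ K ^ n).coeff i ≤ D / √(n + 1) := by
  obtain ⟨k, hk, hμk⟩ := h.exists_two_le_pos
  have hμ0 := h.zero_pos
  set a := min (μ 0) (μ k) with ha
  have ha0 : 0 < a := lt_min hμ0 hμk
  refine ⟨1 + 1 / (2 * a), by positivity, fun n i => ?_⟩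
  have e : genPoly μ K = C a * (1 + X ^ k) + (genPoly μ K - C a * (1 + X ^ k)) := by ring
  rw [e]
  refine coeff_pow_le_div_sqrt (by omega) ha0 (fun j => ?_) ?_ n i
  · rw [coeff_sub, genPoly_coeff h.2.2.2.2.2, coeff_C_mul, coeff_add, coeff_one, coeff_X_pow]
    have hj := h.1 j
    have h1 : a ≤ μ 0 := min_le_left _ _
    have h2 : a ≤ μ k := min_le_right _ _
    split_ifs with hj0 hjk hjk
    · omega
    · subst hj0; linarith
    · subst hjk; linarith
    · linarith
  · simp [h.genPoly_eval_one]; ring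

end H1

end LocalLimitBounds

/-- Assume (H1).  Then `sup_{n ≥ 0} sup_{x ≥ 0} x · P(W_n = x)` is finite. -/
theorem statement6
    (μ : ℕ → ℝ) (K : ℕ) (hμ : H1 μ K) :
    ∃ C : ℝ, ∀ n : ℕ, ∀ x : ℕ, (x : ℝ) * walkProb μ n (x : ℤ) ≤ C := by
  obtain ⟨D, hD, hcoeff⟩ := hμ.exists_coeff_genPoly_pow_le
  have hnn : ∀ i, 0 ≤ (genPoly μ K).coeff i := fun i => by
    rw [genPoly_coeff hμ.2.2.2.2.2]
    exact hμ.1 i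
  refine ⟨3 * ((1 + |(genPoly μ K).derivative.derivative.eval 1|) * D), fun n x => ?_⟩
  have h := Polynomial.mul_coeff_pow_le hnn hD (by positivity) hcoeff
    (Polynomial.sum_pow_mul_abs_sub_le hnn hμ.genPoly_eval_one hμ.derivative_genPoly_eval_one) n x
  rw [walkProb_eq_coeff hμ.2.2.2.2.2, if_pos (by positivity)]
  exact_mod_cast h

end
end

section
/- Assume (H1), and let σ_μ² ∈ (0,∞) denote the variance of μ and d = gcd{k ≥ 1 : μ_k > 0}. Let 𝐓 be a Galton–Watson tree with offspring distribution μ. Then, as n → ∞ along integers n ∈ 1 + dℕ (the support of |𝐓|), one has P(|𝐓| = n) ∼ d · n^{−3/2} / (√(2π) σ_μ), i.e. n^{3/2} P(|𝐓| = n) → d/(√(2π) σ_μ) along this subsequence. -/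
open scoped Classical
open Filter Real
noncomputable section

/-- Variance of `μ` (whose mean is 1 under (H1)). -/
def gwVar (μ : ℕ → ℝ) : ℝ := ∑' k : ℕ, ((k : ℝ) - 1) ^ 2 * μ k

namespace IsPlanarTree

variable {T : Finset (List ℕ)}

lemma mem_of_append_mem (hT : IsPlanarTree T) (u w : List ℕ) (h : u ++ w ∈ T) : u ∈ T := by
  induction w using List.reverseRecOn with
  | nil => simpa using h
  | append_singleton w i ih =>
    exact ih (hT.2 (u ++ w) i (by simpa using h)).2.1

lemma one_le_of_mem (hT : IsPlanarTree T) {u w : List ℕ} {i : ℕ} (h : u ++ i :: w ∈ T) :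
    1 ≤ i :=
  (hT.2 u i (hT.mem_of_append_mem (u ++ [i]) w (by simpa using h))).1

lemma append_singleton_mem_iff (hT : IsPlanarTree T) (u : List ℕ) (i : ℕ) :
    u ++ [i] ∈ T ↔ 1 ≤ i ∧ i ≤ numChildren T u := by
  have hinj : Function.Injective fun i : ℕ => u ++ [i] := fun a b h => by simpa using h
  set I : Finset ℕ := T.preimage (fun i => u ++ [i]) hinj.injOn with hI
  have hmem : ∀ j, j ∈ I ↔ u ++ [j] ∈ T := fun j => by simp [hI]
  have hcard : numChildren T u = I.card := by
    rw [← Finset.card_image_of_injective I hinj, numChildren]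
    congr 1
    ext v
    simp only [Finset.mem_filter, Finset.mem_image, hmem]
    constructor
    · rintro ⟨hv, j, rfl⟩
      exact ⟨j, hv, rfl⟩
    · rintro ⟨j, hj, rfl⟩
      exact ⟨hj, j, rfl⟩
  rw [hcard, ← hmem]
  constructor
  · intro hi
    have h := hT.2 u i ((hmem i).1 hi)
    refine ⟨h.1, ?_⟩
    have hsub : Finset.Icc 1 i ⊆ I := fun j hj => by
      rw [Finset.mem_Icc] at hj
      exact (hmem j).2 (h.2.2 j hj.1 hj.2)
    simpa using Finset.card_le_card hsub
  · rintro ⟨h1, h2⟩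
    by_contra hi
    have hsub : I ⊆ Finset.Icc 1 (i - 1) := fun j hj => by
      have h := hT.2 u j ((hmem j).1 hj)
      rw [Finset.mem_Icc]
      refine ⟨h.1, ?_⟩
      by_contra hlt
      exact hi ((hmem i).2 (h.2.2 i h1 (by omega)))
    have := Finset.card_le_card hsub
    simp at this
    omega

lemma numChildren_eq (hT : IsPlanarTree T) {u : List ℕ} {c : ℕ}
    (h : ∀ i, u ++ [i] ∈ T ↔ 1 ≤ i ∧ i ≤ c) : numChildren T u = c := by
  have h' := fun i => (hT.append_singleton_mem_iff u i).symm.trans (h i)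
  have h1 := h' c
  have h2 := h' (numChildren T u)
  omega

lemma singleton_mem_iff (hT : IsPlanarTree T) (i : ℕ) :
    [i] ∈ T ↔ 1 ≤ i ∧ i ≤ numChildren T [] := by
  simpa using hT.append_singleton_mem_iff [] i

lemma head_le (hT : IsPlanarTree T) {i : ℕ} {w : List ℕ} (h : i :: w ∈ T) :
    1 ≤ i ∧ i ≤ numChildren T [] :=
  (hT.singleton_mem_iff i).1 (hT.mem_of_append_mem [i] w (by simpa using h))

lemma eq_singleton_of_numChildren_nil (hT : IsPlanarTree T) (h : numChildren T [] = 0) :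
    T = {[]} := by
  ext u
  rw [Finset.mem_singleton]
  constructor
  · intro hu
    cases u with
    | nil => rfl
    | cons i w => have := hT.head_le hu; omega
  · rintro rfl
    exact hT.1

end IsPlanarTree

lemma isPlanarTree_singleton_nil : IsPlanarTree {[]} := by
  constructor <;> simp

lemma numChildren_singleton_nil : numChildren {[]} [] = 0 := by
  apply isPlanarTree_singleton_nil.numChildren_eq
  intro i
  simp
  omega

lemma numChildren_nil_lt_card {T : Finset (List ℕ)} (hT : IsPlanarTree T) :
    numChildren T [] < T.card := by
  apply Finset.card_lt_card
  refine ⟨Finset.filter_subset _ _, fun h => ?_⟩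
  simpa using h hT.1

/-- The relabelling of words under which the children of the root with label `> k` become
the children of a new vertex `[k + 1]`. -/
def graft (k : ℕ) : List ℕ → List ℕ
  | [] => []
  | i :: w => if i ≤ k then i :: w else (k + 1) :: (i - k) :: w

/-- Attach the subtrees of the root with label `> k` to a new vertex `[k + 1]`. -/
def graftTree (k : ℕ) (T : Finset (List ℕ)) : Finset (List ℕ) :=
  insert [k + 1] (T.image (graft k))

lemma graft_injective (k : ℕ) : Function.Injective (graft k) := by
  intro u v h
  cases u <;> cases v <;> simp only [graft] at h
  · rfl
  · split_ifs at h
  · split_ifs at h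
  · split_ifs at h <;> simp at h
    · simp [h]
    · omega
    · omega
    · rw [List.cons.injEq]
      exact ⟨by omega, h.2⟩

lemma graft_ne_singleton (k : ℕ) (u : List ℕ) : graft k u ≠ [k + 1] := by
  cases u with
  | nil => simp [graft]
  | cons i w =>
    simp only [graft]
    split_ifs
    · simp; omega
    · simp

lemma graft_eq_nil {k : ℕ} {u : List ℕ} : graft k u = [] ↔ u = [] := by
  cases u with
  | nil => simp [graft]
  | cons i w =>
    simp only [graft]
    split_ifs <;> simp

lemma graft_append {k : ℕ} {u : List ℕ} (hu : u ≠ []) (w : List ℕ) :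
    graft k (u ++ w) = graft k u ++ w := by
  cases u with
  | nil => exact absurd rfl hu
  | cons i v =>
    simp only [graft, List.cons_append]
    split_ifs <;> simp

lemma graft_mem_graftTree {k : ℕ} {T : Finset (List ℕ)} {u : List ℕ} :
    graft k u ∈ graftTree k T ↔ u ∈ T := by
  simp only [graftTree, Finset.mem_insert, graft_ne_singleton, false_or]
  exact (graft_injective k).mem_finset_image

lemma nil_mem_graftTree {k : ℕ} {T : Finset (List ℕ)} : [] ∈ graftTree k T ↔ [] ∈ T :=
  graft_mem_graftTree (k := k) (u := [])

lemma cons_mem_graftTree_of_le {k i : ℕ} {T : Finset (List ℕ)} {w : List ℕ} (hi : i ≤ k) :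
    i :: w ∈ graftTree k T ↔ i :: w ∈ T := by
  have h : graft k (i :: w) = i :: w := by simp [graft, hi]
  rw [← graft_mem_graftTree (k := k) (T := T), h]

lemma singleton_mem_graftTree {k : ℕ} {T : Finset (List ℕ)} : [k + 1] ∈ graftTree k T := by
  simp [graftTree]

lemma cons_cons_mem_graftTree {k j : ℕ} {T : Finset (List ℕ)} {w : List ℕ} (hj : 1 ≤ j) :
    (k + 1) :: j :: w ∈ graftTree k T ↔ (k + j) :: w ∈ T := by
  have h : graft k ((k + j) :: w) = (k + 1) :: j :: w := by
    simp [graft, show ¬ (k + j ≤ k) by omega]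
  rw [← graft_mem_graftTree (k := k) (u := (k + j) :: w), h]

lemma mem_graftTree_cases {k i : ℕ} {T : Finset (List ℕ)} {w : List ℕ}
    (h : i :: w ∈ graftTree k T) :
    (i ≤ k ∧ i :: w ∈ T) ∨
      (i = k + 1 ∧ (w = [] ∨ ∃ j w', w = j :: w' ∧ 1 ≤ j ∧ (k + j) :: w' ∈ T)) := by
  simp only [graftTree, Finset.mem_insert, Finset.mem_image] at h
  rcases h with h | ⟨u, hu, h⟩
  · simp at h
    simp [h]
  · cases u with
    | nil => simp [graft] at h
    | cons a v =>
      simp only [graft] at h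
      split_ifs at h with ha
      · simp at h
        obtain ⟨rfl, rfl⟩ := h
        exact Or.inl ⟨ha, hu⟩
      · simp at h
        obtain ⟨rfl, rfl⟩ := h
        refine Or.inr ⟨rfl, Or.inr ⟨a - k, v, rfl, by omega, ?_⟩⟩
        rwa [show k + (a - k) = a by omega]

lemma IsPlanarTree.graftTree {k : ℕ} {T : Finset (List ℕ)} (hT : IsPlanarTree T)
    (hk : k ≤ numChildren T []) : IsPlanarTree (graftTree k T) := by
  refine ⟨nil_mem_graftTree.2 hT.1, fun u i h => ?_⟩
  cases u with
  | nil =>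
    have hi : 1 ≤ i ∧ i ≤ k + 1 := by
      rcases mem_graftTree_cases h with ⟨h1, h2⟩ | ⟨h1, -⟩
      · have := hT.head_le h2
        omega
      · omega
    refine ⟨hi.1, nil_mem_graftTree.2 hT.1, fun j h1 h2 => ?_⟩
    rcases Nat.lt_or_ge k j with hj | hj
    · obtain rfl : j = k + 1 := by omega
      exact singleton_mem_graftTree
    · exact (cons_mem_graftTree_of_le hj).2 ((hT.singleton_mem_iff j).2 ⟨h1, by omega⟩)
  | cons a v =>
    rcases mem_graftTree_cases h with ⟨h1, h2⟩ | ⟨rfl, h2 | ⟨j, w', hw, hj, h3⟩⟩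
    · have := hT.2 (a :: v) i h2
      refine ⟨this.1, (cons_mem_graftTree_of_le h1).2 this.2.1, fun j hj hji => ?_⟩
      exact (cons_mem_graftTree_of_le h1).2 (this.2.2 j hj hji)
    · simp at h2
    · cases v with
      | nil =>
        simp at hw
        obtain ⟨rfl, rfl⟩ := hw
        have := hT.head_le h3
        refine ⟨hj, singleton_mem_graftTree, fun j hj' hji => ?_⟩
        exact (cons_cons_mem_graftTree hj').2 ((hT.singleton_mem_iff _).2 (by omega))
      | cons b v' =>
        simp at hw
        obtain ⟨rfl, rfl⟩ := hw
        have := hT.2 ((k + b) :: v') i h3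
        refine ⟨this.1, (cons_cons_mem_graftTree hj).2 this.2.1, fun j hj' hji => ?_⟩
        exact (cons_cons_mem_graftTree hj).2 (this.2.2 j hj' hji)

lemma card_graftTree (k : ℕ) (T : Finset (List ℕ)) : (graftTree k T).card = T.card + 1 := by
  rw [graftTree, Finset.card_insert_of_notMem, Finset.card_image_of_injective _ (graft_injective k)]
  simp only [Finset.mem_image, not_exists, not_and]
  exact fun u _ => graft_ne_singleton k u

lemma graftTree_injective (k : ℕ) : Function.Injective (graftTree k) := by
  intro S T h
  ext u
  rw [← graft_mem_graftTree (k := k), h, graft_mem_graftTree]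

lemma numChildren_graftTree_nil {k : ℕ} {T : Finset (List ℕ)} (hT : IsPlanarTree T)
    (hk : k ≤ numChildren T []) : numChildren (graftTree k T) [] = k + 1 := by
  refine (hT.graftTree hk).numChildren_eq fun i => ⟨fun h => ?_, fun h => ?_⟩
  · refine ⟨((hT.graftTree hk).2 [] i h).1, ?_⟩
    rcases mem_graftTree_cases h with ⟨h1, -⟩ | ⟨h1, -⟩ <;> omega
  · rcases Nat.lt_or_ge k i with hj | hj
    · obtain rfl : i = k + 1 := by omega
      exact singleton_mem_graftTree
    · exact (cons_mem_graftTree_of_le hj).2 ((hT.singleton_mem_iff i).2 ⟨h.1, by omega⟩)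

lemma numChildren_graftTree_singleton {k : ℕ} {T : Finset (List ℕ)} (hT : IsPlanarTree T)
    (hk : k ≤ numChildren T []) :
    numChildren (graftTree k T) [k + 1] = numChildren T [] - k := by
  refine (hT.graftTree hk).numChildren_eq fun i => ⟨fun h => ?_, fun h => ?_⟩
  · have h1 := ((hT.graftTree hk).2 [k + 1] i h).1
    have := hT.head_le ((cons_cons_mem_graftTree h1).1 h)
    omega
  · exact (cons_cons_mem_graftTree h.1).2 ((hT.singleton_mem_iff _).2 (by omega))

lemma numChildren_graftTree_graft {k : ℕ} {T : Finset (List ℕ)} (hT : IsPlanarTree T)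
    (hk : k ≤ numChildren T []) {u : List ℕ} (hu : u ≠ []) :
    numChildren (graftTree k T) (graft k u) = numChildren T u := by
  refine (hT.graftTree hk).numChildren_eq fun i => ?_
  rw [← graft_append hu, graft_mem_graftTree, hT.append_singleton_mem_iff]

lemma exists_graftTree_eq {k : ℕ} {T : Finset (List ℕ)} (hT : IsPlanarTree T)
    (hk : numChildren T [] = k + 1) :
    ∃ S, IsPlanarTree S ∧ k ≤ numChildren S [] ∧ graftTree k S = T := by
  set S : Finset (List ℕ) := T.preimage (graft k) (graft_injective k).injOn with hS
  have hmem : ∀ u, u ∈ S ↔ graft k u ∈ T := fun u => by simp [hS]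
  have hST : graftTree k S = T := by
    ext u
    constructor
    · intro h
      simp only [graftTree, Finset.mem_insert, Finset.mem_image] at h
      rcases h with rfl | ⟨v, hv, rfl⟩
      · exact (hT.singleton_mem_iff _).2 (by omega)
      · exact (hmem v).1 hv
    · intro h
      cases u with
      | nil => exact nil_mem_graftTree.2 ((hmem []).2 h)
      | cons i w =>
        have hi := hT.head_le h
        rcases Nat.lt_or_ge k i with hki | hki
        · obtain rfl : i = k + 1 := by omega
          cases w with
          | nil => exact singleton_mem_graftTree
          | cons j w =>
            have hj : 1 ≤ j := hT.one_le_of_mem (u := [k + 1]) h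
            rw [cons_cons_mem_graftTree hj, hmem]
            simpa [graft, show ¬ (k + j ≤ k) by omega] using h
        · rw [cons_mem_graftTree_of_le hki, hmem]
          simpa [graft, hki] using h
  have hSp : IsPlanarTree S := by
    refine ⟨(hmem []).2 hT.1, fun u i h => ?_⟩
    rw [hmem] at h
    by_cases hu : u = []
    · subst hu
      simp only [List.nil_append, hmem, graft] at h ⊢
      split_ifs at h with hi
      · have h' := hT.head_le h
        refine ⟨h'.1, hT.1, fun j h1 h2 => ?_⟩
        rw [if_pos (by omega)]
        exact (hT.singleton_mem_iff _).2 (by omega)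
      · refine ⟨by omega, hT.1, fun j h1 h2 => ?_⟩
        split_ifs with hj
        · exact (hT.singleton_mem_iff _).2 (by omega)
        · exact (hT.2 [k + 1] (i - k) h).2.2 _ (by omega) (by omega)
    · rw [graft_append hu] at h
      have h' := hT.2 _ _ h
      refine ⟨h'.1, (hmem u).2 h'.2.1, fun j h1 h2 => ?_⟩
      rw [hmem, graft_append hu]
      exact h'.2.2 j h1 h2
  refine ⟨S, hSp, ?_, hST⟩
  rcases Nat.eq_zero_or_pos k with rfl | hpos
  · omega
  · refine ((hSp.singleton_mem_iff k).1 ((hmem _).2 ?_)).2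
    simp only [graft, le_refl, if_true]
    exact (hT.singleton_mem_iff _).2 (by omega)

lemma finite_planarTree_card (n : ℕ) :
    {T : Finset (List ℕ) | IsPlanarTree T ∧ T.card = n}.Finite := by
  induction n with
  | zero =>
    convert Set.finite_empty
    ext T
    simp only [Set.mem_ofPred_eq, Set.mem_empty_iff_false, iff_false, Finset.card_eq_zero]
    rintro ⟨hT, rfl⟩
    exact absurd hT.1 (Finset.notMem_empty _)
  | succ n ih =>
    refine ((Set.finite_singleton {[]}).union
      ((Finset.range (n + 1)).finite_toSet.biUnion fun k _ => ih.image (graftTree k))).subset ?_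
    rintro T ⟨hT, hc⟩
    have hlt := numChildren_nil_lt_card hT
    rcases hk : numChildren T [] with _ | k
    · exact Or.inl (hT.eq_singleton_of_numChildren_nil hk)
    · obtain ⟨S, hS, -, rfl⟩ := exists_graftTree_eq hT hk
      rw [card_graftTree] at hc
      refine Or.inr (Set.mem_biUnion (x := k) ?_ ⟨S, ⟨hS, by omega⟩, rfl⟩)
      rw [card_graftTree] at hlt
      simp
      omega

/-- The finite set of planar trees with `n` vertices. -/
def planarTrees (n : ℕ) : Finset (Finset (List ℕ)) := (finite_planarTree_card n).toFinset

lemma mem_planarTrees {n : ℕ} {T : Finset (List ℕ)} :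
    T ∈ planarTrees n ↔ IsPlanarTree T ∧ T.card = n := by
  simp [planarTrees]

lemma planarTrees_one : planarTrees 1 = {{[]}} := by
  ext T
  rw [mem_planarTrees, Finset.mem_singleton]
  constructor
  · rintro ⟨hT, hc⟩
    have := numChildren_nil_lt_card hT
    exact hT.eq_singleton_of_numChildren_nil (by omega)
  · rintro rfl
    exact ⟨isPlanarTree_singleton_nil, rfl⟩

/-- Galton-Watson weight of the forest obtained from `T` by removing its root. -/
def forestWeight (μ : ℕ → ℝ) (T : Finset (List ℕ)) : ℝ :=
  ∏ u ∈ T.erase [], μ (numChildren T u)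

/-- Probability that a Galton-Watson forest of `k` trees has `n` vertices. -/
def forestProb (μ : ℕ → ℝ) (n k : ℕ) : ℝ :=
  ∑ T ∈ planarTrees (n + 1) with numChildren T [] = k, forestWeight μ T

lemma gwWeight_eq_mul_forestWeight (μ : ℕ → ℝ) {T : Finset (List ℕ)} (hT : IsPlanarTree T) :
    gwWeight μ T = μ (numChildren T []) * forestWeight μ T :=
  (Finset.mul_prod_erase T _ hT.1).symm

lemma forestWeight_graftTree (μ : ℕ → ℝ) {k : ℕ} {T : Finset (List ℕ)} (hT : IsPlanarTree T)
    (hk : k ≤ numChildren T []) :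
    forestWeight μ (graftTree k T) = μ (numChildren T [] - k) * forestWeight μ T := by
  have h : (graftTree k T).erase [] = insert [k + 1] ((T.erase []).image (graft k)) := by
    ext u
    simp only [graftTree, Finset.mem_erase, Finset.mem_insert, Finset.mem_image]
    constructor
    · rintro ⟨h1, rfl | ⟨v, hv, rfl⟩⟩
      · exact Or.inl rfl
      · exact Or.inr ⟨v, ⟨fun h => h1 (graft_eq_nil.2 h), hv⟩, rfl⟩
    · rintro (rfl | ⟨v, ⟨hv1, hv⟩, rfl⟩)
      · simp
      · exact ⟨fun h => hv1 (graft_eq_nil.1 h), Or.inr ⟨v, hv, rfl⟩⟩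
  rw [forestWeight, h, Finset.prod_insert, Finset.prod_image (graft_injective k).injOn,
    numChildren_graftTree_singleton hT hk, forestWeight]
  · congr 1
    refine Finset.prod_congr rfl fun u hu => ?_
    rw [numChildren_graftTree_graft hT hk (Finset.ne_of_mem_erase hu)]
  · simp only [Finset.mem_image, not_exists, not_and]
    exact fun u _ => graft_ne_singleton k u

lemma forestProb_zero (μ : ℕ → ℝ) (k : ℕ) : forestProb μ 0 k = if k = 0 then 1 else 0 := by
  rw [forestProb, zero_add, planarTrees_one, Finset.sum_filter, Finset.sum_singleton,
    numChildren_singleton_nil]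
  simp [forestWeight, eq_comm]

lemma forestProb_succ_zero (μ : ℕ → ℝ) (n : ℕ) : forestProb μ (n + 1) 0 = 0 := by
  rw [forestProb, Finset.sum_eq_zero]
  intro T hT
  rw [Finset.mem_filter, mem_planarTrees] at hT
  have := hT.1.1.eq_singleton_of_numChildren_nil hT.2
  rw [this] at hT
  simp at hT

lemma sum_mul_forestProb {μ : ℕ → ℝ} {K : ℕ} (hK : ∀ k, K < k → μ k = 0) (n k : ℕ) :
    ∑ j ∈ Finset.range (K + 1), μ j * forestProb μ n (k + j) =
      ∑ T ∈ planarTrees (n + 1) with k ≤ numChildren T [],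
        μ (numChildren T [] - k) * forestWeight μ T := by
  simp only [forestProb, Finset.mul_sum, Finset.sum_filter]
  rw [Finset.sum_comm]
  refine Finset.sum_congr rfl fun T _ => ?_
  split_ifs with h
  · rw [Finset.sum_eq_single (numChildren T [] - k)]
    · rw [if_pos (by omega)]
    · intro j _ hj
      rw [if_neg (by omega), mul_zero]
    · intro hj
      rw [hK _ (by rw [Finset.mem_range] at hj; omega), zero_mul]
  · refine Finset.sum_eq_zero fun j _ => ?_
    rw [if_neg (by omega), mul_zero]

lemma forestProb_succ_succ {μ : ℕ → ℝ} {K : ℕ} (hK : ∀ k, K < k → μ k = 0) (n k : ℕ) :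
    forestProb μ (n + 1) (k + 1) =
      ∑ j ∈ Finset.range (K + 1), μ j * forestProb μ n (k + j) := by
  rw [sum_mul_forestProb hK, forestProb]
  symm
  refine Finset.sum_bij (fun T _ => graftTree k T) ?_ ?_ ?_ ?_
  · intro T hT
    rw [Finset.mem_filter, mem_planarTrees] at hT ⊢
    exact ⟨⟨hT.1.1.graftTree hT.2, by rw [card_graftTree, hT.1.2]⟩,
      numChildren_graftTree_nil hT.1.1 hT.2⟩
  · exact fun S _ T _ h => graftTree_injective k h
  · intro T hT
    rw [Finset.mem_filter, mem_planarTrees] at hT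
    obtain ⟨S, hS, hk, rfl⟩ := exists_graftTree_eq hT.1.1 hT.2
    rw [card_graftTree] at hT
    refine ⟨S, ?_, rfl⟩
    rw [Finset.mem_filter, mem_planarTrees]
    exact ⟨⟨hS, by omega⟩, hk⟩
  · intro T hT
    rw [Finset.mem_filter, mem_planarTrees] at hT
    exact (forestWeight_graftTree μ hT.1.1 hT.2).symm

lemma treeSizeProb_succ {μ : ℕ → ℝ} {K : ℕ} (hK : ∀ k, K < k → μ k = 0) (n : ℕ) :
    treeSizeProb μ (n + 1) = ∑ j ∈ Finset.range (K + 1), μ j * forestProb μ n j := by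
  have h := sum_mul_forestProb hK n 0
  simp only [zero_add, zero_le, Finset.filter_true, Nat.sub_zero] at h
  rw [h, treeSizeProb, gwProb]
  let e : {T : PlanarTree | T.val.card = n + 1} ≃ planarTrees (n + 1) :=
    { toFun := fun T => ⟨T.1.1, mem_planarTrees.2 ⟨T.1.2, T.2⟩⟩
      invFun := fun T => ⟨⟨T.1, (mem_planarTrees.1 T.2).1⟩, (mem_planarTrees.1 T.2).2⟩
      left_inv := fun T => rfl
      right_inv := fun T => rfl }
  rw [show (∑' T : {T : PlanarTree | T.val.card = n + 1}, gwWeight μ (T : PlanarTree).val) =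
    ∑' T : planarTrees (n + 1), gwWeight μ T from
      e.tsum_eq (fun T : planarTrees (n + 1) => gwWeight μ T), tsum_fintype,
    Finset.sum_coe_sort (planarTrees (n + 1)) (gwWeight μ)]
  exact Finset.sum_congr rfl fun T hT =>
    gwWeight_eq_mul_forestWeight μ (mem_planarTrees.1 hT).1

/-- The generating polynomial of an offspring distribution supported in `{0, …, K}`. -/
def offspringPoly (μ : ℕ → ℝ) (K : ℕ) : Polynomial ℝ :=
  ∑ k ∈ Finset.range (K + 1), Polynomial.monomial k (μ k)

lemma coeff_offspringPoly {μ : ℕ → ℝ} {K : ℕ} (hK : ∀ k, K < k → μ k = 0) (k : ℕ) :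
    (offspringPoly μ K).coeff k = μ k := by
  simp only [offspringPoly, Polynomial.finsetSum_coeff, Polynomial.coeff_monomial,
    Finset.sum_ite_eq', Finset.mem_range]
  split_ifs with h
  · rfl
  · exact (hK k (by omega)).symm

lemma Polynomial.coeff_mul_eq_sum_range {A B : Polynomial ℝ} {K : ℕ}
    (hA : ∀ k, K < k → A.coeff k = 0) (N : ℕ) :
    (A * B).coeff N =
      ∑ j ∈ Finset.range (K + 1), A.coeff j * if j ≤ N then B.coeff (N - j) else 0 := by
  rw [Polynomial.coeff_mul, Finset.Nat.sum_antidiagonal_eq_sum_range_succ_mk]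
  have h1 : ∑ j ∈ Finset.range N.succ, A.coeff j * B.coeff (N - j) =
      ∑ j ∈ Finset.range (N + K + 1), A.coeff j * if j ≤ N then B.coeff (N - j) else 0 := by
    rw [← Finset.sum_subset (Finset.range_mono (show N + 1 ≤ N + K + 1 by omega))]
    · refine Finset.sum_congr rfl fun j hj => ?_
      rw [if_pos (by simpa [Nat.lt_succ_iff] using hj)]
    · intro j _ hj
      rw [if_neg (by simpa using hj), mul_zero]
  rw [h1]
  symm
  refine Finset.sum_subset (Finset.range_mono (show K + 1 ≤ N + K + 1 by omega)) ?_
  intro j _ hj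
  rw [hA j (by simpa using hj), zero_mul]

/-- One step of the induction for the Dwass formula, by the exchangeability of the increments. -/
lemma sum_mul_add_mul_coeff_pow {μ : ℕ → ℝ} {K : ℕ} (hK : ∀ k, K < k → μ k = 0) (n N : ℕ)
    (k : ℝ) :
    (n + 1) * ∑ j ∈ Finset.range (K + 1), μ j *
        ((k + j) * if j ≤ N then (offspringPoly μ K ^ n).coeff (N - j) else 0) =
      ((n + 1) * k + N) * (offspringPoly μ K ^ (n + 1)).coeff N := by
  set φ := offspringPoly μ K with hφ
  have h1 : (φ ^ (n + 1)).coeff N = ∑ j ∈ Finset.range (K + 1), μ j *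
      if j ≤ N then (φ ^ n).coeff (N - j) else 0 := by
    rw [pow_succ', Polynomial.coeff_mul_eq_sum_range (K := K)]
    · simp only [hφ, coeff_offspringPoly hK]
    · simpa only [hφ, coeff_offspringPoly hK] using hK
  have hc : ∀ j, (Polynomial.X * Polynomial.derivative φ).coeff j = j * μ j := by
    intro j
    cases j with
    | zero => simp
    | succ j =>
      rw [Polynomial.coeff_X_mul, Polynomial.coeff_derivative, hφ, coeff_offspringPoly hK]
      push_cast
      ring
  have h2 : (Polynomial.X * Polynomial.derivative φ * φ ^ n).coeff N =
      ∑ j ∈ Finset.range (K + 1), (j * μ j) *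
        if j ≤ N then (φ ^ n).coeff (N - j) else 0 := by
    rw [Polynomial.coeff_mul_eq_sum_range (K := K)]
    · simp only [hc]
    · intro j hj
      rw [hc, hK j hj, mul_zero]
  have h3 : (n + 1) * (Polynomial.X * Polynomial.derivative φ * φ ^ n).coeff N =
      N * (φ ^ (n + 1)).coeff N := by
    have h : Polynomial.X * Polynomial.derivative (φ ^ (n + 1)) =
        Polynomial.C (n + 1 : ℝ) * (Polynomial.X * Polynomial.derivative φ * φ ^ n) := by
      rw [Polynomial.derivative_pow_succ]
      ring
    rw [← Polynomial.coeff_C_mul, ← h]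
    cases N with
    | zero => simp
    | succ N =>
      rw [Polynomial.coeff_X_mul, Polynomial.coeff_derivative]
      push_cast
      ring
  calc _ = (n + 1) * k * (∑ j ∈ Finset.range (K + 1), μ j *
      if j ≤ N then (φ ^ n).coeff (N - j) else 0) +
      (n + 1) * ∑ j ∈ Finset.range (K + 1), (j * μ j) *
        if j ≤ N then (φ ^ n).coeff (N - j) else 0 := by
        simp only [Finset.mul_sum, ← Finset.sum_add_distrib]
        exact Finset.sum_congr rfl fun j _ => by ring
    _ = _ := by
      rw [← h1, ← h2, h3]
      ring

lemma sum_mul_forestProb_eq {μ : ℕ → ℝ} {K : ℕ} (hK : ∀ k, K < k → μ k = 0) (n k : ℕ) :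
    (n + 1) * ∑ j ∈ Finset.range (K + 1), μ j * forestProb μ n (k + j) =
      (k + 1) * if k ≤ n then (offspringPoly μ K ^ (n + 1)).coeff (n - k) else 0 := by
  induction n generalizing k with
  | zero =>
    have h : ∑ j ∈ Finset.range (K + 1), μ j * forestProb μ 0 (k + j) =
        if k = 0 then μ 0 else 0 := by
      rw [Finset.sum_eq_single 0]
      · simp [forestProb_zero]
      · intro j _ hj
        rw [forestProb_zero, if_neg (by omega), mul_zero]
      · simp
    rw [h]
    by_cases hk : k = 0
    · simp [hk, coeff_offspringPoly hK]
    · simp [hk]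
  | succ n ih =>
    have hq : ∀ i, (n + 1 : ℝ) * forestProb μ (n + 1) i =
        i * if i ≤ n + 1 then (offspringPoly μ K ^ (n + 1)).coeff (n + 1 - i) else 0 := by
      intro i
      cases i with
      | zero => simp [forestProb_succ_zero]
      | succ i =>
        rw [forestProb_succ_succ hK, ih i]
        simp
    have hn : (n + 1 : ℝ) ≠ 0 := by positivity
    apply mul_left_cancel₀ hn
    split_ifs with hk
    · have h := sum_mul_add_mul_coeff_pow hK (n + 1) (n + 1 - k) k
      have hcongr : ∀ j, μ j * ((k + j : ℝ) * if j ≤ n + 1 - k then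
          (offspringPoly μ K ^ (n + 1)).coeff (n + 1 - k - j) else 0) =
          (n + 1) * (μ j * forestProb μ (n + 1) (k + j)) := by
        intro j
        rw [mul_left_comm (n + 1 : ℝ), hq (k + j)]
        have : j ≤ n + 1 - k ↔ k + j ≤ n + 1 := by omega
        simp only [this, Nat.sub_sub]
        push_cast
        rfl
      simp only [hcongr, ← Finset.mul_sum] at h
      rw [Nat.cast_sub hk] at h
      push_cast at h ⊢
      linear_combination h
    · rw [Finset.sum_eq_zero]
      · simp
      · intro j _
        have := hq (k + j)
        rw [if_neg (by omega), mul_zero] at this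
        rw [(mul_eq_zero.1 this).resolve_left hn, mul_zero]

/-- Otter-Dwass formula. -/
lemma succ_mul_treeSizeProb_succ {μ : ℕ → ℝ} {K : ℕ} (hK : ∀ k, K < k → μ k = 0) (n : ℕ) :
    (n + 1) * treeSizeProb μ (n + 1) = (offspringPoly μ K ^ (n + 1)).coeff n := by
  have h := sum_mul_forestProb_eq hK n 0
  simpa [treeSizeProb_succ hK] using h

open MeasureTheory

lemma integral_exp_int_mul (k : ℤ) :
    ∫ t in (-π)..π, Complex.exp (Complex.I * k * t) = if k = 0 then (2 * π : ℂ) else 0 := by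
  split_ifs with hk
  · simp [hk]
    ring
  · have hc : Complex.I * k ≠ 0 := mul_ne_zero Complex.I_ne_zero (by exact_mod_cast hk)
    rw [integral_exp_mul_complex hc, div_eq_zero_iff]
    left
    rw [sub_eq_zero, Complex.exp_eq_exp_iff_exists_int]
    refine ⟨k, ?_⟩
    push_cast
    ring

lemma integral_exp_mul_aeval_exp (Q : Polynomial ℝ) (m : ℕ) :
    ∫ t in (-π)..π, Complex.exp (-(Complex.I * m * t)) *
      Polynomial.aeval (Complex.exp (Complex.I * t)) Q = 2 * π * Q.coeff m := by
  have h : ∀ t : ℝ, Complex.exp (-(Complex.I * m * t)) *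
      Polynomial.aeval (Complex.exp (Complex.I * t)) Q =
      ∑ j ∈ Finset.range (Q.natDegree + 1),
        (Q.coeff j : ℂ) * Complex.exp (Complex.I * ((j - m : ℤ) : ℂ) * t) := by
    intro t
    rw [Polynomial.aeval_eq_sum_range, Finset.mul_sum]
    refine Finset.sum_congr rfl fun j _ => ?_
    rw [Complex.real_smul, mul_left_comm, ← Complex.exp_nat_mul, ← Complex.exp_add]
    congr 2
    push_cast
    ring
  simp only [h]
  rw [intervalIntegral.integral_finsetSum]
  · simp only [intervalIntegral.integral_const_mul, integral_exp_int_mul, sub_eq_zero,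
      Nat.cast_inj, mul_ite, mul_zero, Finset.sum_ite_eq', Finset.mem_range]
    split_ifs with hm
    · ring
    · rw [Polynomial.coeff_eq_zero_of_natDegree_lt (by omega)]
      simp
  · intro j _
    exact Continuous.intervalIntegrable (by fun_prop) _ _

/-- Characteristic function of `(ξ - 1) / d` where `ξ` has distribution `μ`. -/
def stepCharFun (μ : ℕ → ℝ) (K d : ℕ) (t : ℝ) : ℂ :=
  ∑ k ∈ Finset.range (K + 1), (μ k : ℂ) * Complex.exp (((t * ((k - 1) / d) : ℝ) : ℂ) * Complex.I)

lemma continuous_stepCharFun (μ : ℕ → ℝ) (K d : ℕ) : Continuous (stepCharFun μ K d) := by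
  unfold stepCharFun
  fun_prop

lemma expand_contract_offspringPoly {μ : ℕ → ℝ} {K d : ℕ} (hK : ∀ k, K < k → μ k = 0)
    (hd : 0 < d) (hdvd : ∀ k, 1 ≤ k → μ k ≠ 0 → d ∣ k) :
    Polynomial.expand ℝ d (Polynomial.contract d (offspringPoly μ K)) = offspringPoly μ K := by
  ext n
  rw [Polynomial.coeff_expand hd]
  split_ifs with h
  · rw [Polynomial.coeff_contract hd.ne', Nat.div_mul_cancel h]
  · rw [coeff_offspringPoly hK]
    by_contra hn
    refine h (hdvd n ?_ (Ne.symm hn))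
    rcases Nat.eq_zero_or_pos n with rfl | h'
    · simp at h
    · exact h'

lemma coeff_offspringPoly_pow {μ : ℕ → ℝ} {K d : ℕ} (hK : ∀ k, K < k → μ k = 0)
    (hd : 0 < d) (hdvd : ∀ k, 1 ≤ k → μ k ≠ 0 → d ∣ k) (m : ℕ) :
    2 * π * ((offspringPoly μ K ^ (1 + d * m)).coeff (d * m) : ℂ) =
      ∫ t in (-π)..π, Complex.exp (((t / d : ℝ) : ℂ) * Complex.I) *
        stepCharFun μ K d t ^ (1 + d * m) := by
  have hd' : (d : ℂ) ≠ 0 := by exact_mod_cast hd.ne'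
  have hexp := expand_contract_offspringPoly hK hd hdvd
  set ψ := Polynomial.contract d (offspringPoly μ K)
  have hψ : ∀ t : ℝ, Polynomial.aeval (Complex.exp (Complex.I * t)) ψ =
      Complex.exp (((t / d : ℝ) : ℂ) * Complex.I) * stepCharFun μ K d t := by
    intro t
    have h1 : Complex.exp (Complex.I * t) = Complex.exp (((t / d : ℝ) : ℂ) * Complex.I) ^ d := by
      rw [← Complex.exp_nat_mul]
      congr 1
      push_cast
      field_simp
    rw [h1, ← Polynomial.expand_aeval, hexp, offspringPoly, map_sum, stepCharFun, Finset.mul_sum]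
    refine Finset.sum_congr rfl fun k _ => ?_
    rw [Polynomial.aeval_monomial, ← Complex.exp_nat_mul,
      mul_left_comm (Complex.exp _) (μ k : ℂ), ← Complex.exp_add, Complex.coe_algebraMap]
    congr 2
    push_cast
    ring
  rw [← hexp, ← map_pow, Polynomial.coeff_expand_mul' hd, ← integral_exp_mul_aeval_exp]
  refine intervalIntegral.integral_congr fun t _ => ?_
  simp only [map_pow, hψ]
  rw [mul_pow, ← mul_assoc, ← Complex.exp_nat_mul, ← Complex.exp_add]
  congr 2
  push_cast
  field_simp
  ring

lemma norm_sq_sum_mul_exp {ι : Type*} (s : Finset ι) (p θ : ι → ℝ) :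
    ‖∑ k ∈ s, (p k : ℂ) * Complex.exp ((θ k : ℂ) * Complex.I)‖ ^ 2 =
      ∑ j ∈ s, ∑ k ∈ s, p j * p k * Real.cos (θ j - θ k) := by
  rw [Complex.sq_norm, Complex.normSq_apply]
  simp only [Complex.re_sum, Complex.im_sum, Complex.re_ofReal_mul, Complex.im_ofReal_mul,
    Complex.exp_ofReal_mul_I_re, Complex.exp_ofReal_mul_I_im, Finset.sum_mul_sum,
    ← Finset.sum_add_distrib, Real.cos_sub]
  exact Finset.sum_congr rfl fun j _ => Finset.sum_congr rfl fun k _ => by ring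

lemma cos_eq_one_sub_sinc (x : ℝ) : Real.cos x = 1 - x ^ 2 / 2 * Real.sinc (x / 2) ^ 2 := by
  have h : Real.sin (x / 2) = x / 2 * Real.sinc (x / 2) := by
    by_cases hx : x = 0
    · simp [hx]
    · rw [Real.sinc_of_ne_zero (by simpa using hx)]
      field_simp
  have h2 : Real.cos x = 1 - 2 * Real.sin (x / 2) ^ 2 := by
    have := Real.cos_two_mul (x / 2)
    rw [mul_div_cancel₀ x two_ne_zero] at this
    rw [this, Real.cos_sq']
    ring
  rw [h2, h]
  ring

lemma sum_range_of_H1 {μ : ℕ → ℝ} {K : ℕ} (hμ : H1 μ K) :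
    ∑ k ∈ Finset.range (K + 1), μ k = 1 := by
  rw [← hμ.2.1.tsum_eq, tsum_eq_sum]
  intro k hk
  exact hμ.2.2.2.2.2 k (by simpa using hk)

lemma sum_range_sub_one_mul_of_H1 {μ : ℕ → ℝ} {K : ℕ} (hμ : H1 μ K) :
    ∑ k ∈ Finset.range (K + 1), ((k : ℝ) - 1) * μ k = 0 := by
  have h : ∑ k ∈ Finset.range (K + 1), (k : ℝ) * μ k = 1 := by
    rw [← hμ.2.2.2.1.tsum_eq, tsum_eq_sum]
    intro k hk
    rw [hμ.2.2.2.2.2 k (by simpa using hk), mul_zero]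
  simp only [sub_mul, one_mul, Finset.sum_sub_distrib, h, sum_range_of_H1 hμ, sub_self]

lemma gwVar_eq_sum {μ : ℕ → ℝ} {K : ℕ} (hK : ∀ k, K < k → μ k = 0) :
    gwVar μ = ∑ k ∈ Finset.range (K + 1), ((k : ℝ) - 1) ^ 2 * μ k := by
  rw [gwVar, tsum_eq_sum]
  intro k hk
  rw [hK k (by simpa using hk), mul_zero]

lemma exists_two_le_of_H1 {μ : ℕ → ℝ} {K : ℕ} (hμ : H1 μ K) : ∃ k, 2 ≤ k ∧ 0 < μ k := by
  by_contra! h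
  refine hμ.2.2.1 ?_
  have h0 : ∀ k, k ∉ Finset.range 2 → μ k = 0 := fun k hk =>
    le_antisymm (h k (by rw [Finset.mem_range] at hk; omega)) (hμ.1 k)
  rw [← hμ.2.1.tsum_eq, tsum_eq_sum h0]
  simp [Finset.sum_range_succ]

lemma gwVar_pos {μ : ℕ → ℝ} {K : ℕ} (hμ : H1 μ K) : 0 < gwVar μ := by
  obtain ⟨k, hk, hpos⟩ := exists_two_le_of_H1 hμ
  rw [gwVar_eq_sum hμ.2.2.2.2.2]
  refine Finset.sum_pos' (fun i _ => mul_nonneg (sq_nonneg _) (hμ.1 i)) ⟨k, ?_, ?_⟩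
  · by_contra hK
    exact hpos.ne' (hμ.2.2.2.2.2 k (by simpa using hK))
  · have : (2 : ℝ) ≤ k := by exact_mod_cast hk
    exact mul_pos (pow_pos (by linarith) 2) hpos

lemma zero_pos_of_H1 {μ : ℕ → ℝ} {K : ℕ} (hμ : H1 μ K) : 0 < μ 0 := by
  obtain ⟨k, hk, hpos⟩ := exists_two_le_of_H1 hμ
  have h := sum_range_sub_one_mul_of_H1 hμ
  rw [Finset.sum_range_succ'] at h
  have hsum : 0 < ∑ i ∈ Finset.range K, (((i + 1 : ℕ) : ℝ) - 1) * μ (i + 1) := by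
    refine Finset.sum_pos' (fun i _ => ?_) ⟨k - 1, ?_, ?_⟩
    · push_cast
      rw [add_sub_cancel_right]
      exact mul_nonneg (Nat.cast_nonneg i) (hμ.1 _)
    · rw [Finset.mem_range]
      by_contra hK
      exact hpos.ne' (hμ.2.2.2.2.2 k (by omega))
    · rw [Nat.sub_add_cancel (by omega)]
      have : (2 : ℝ) ≤ k := by exact_mod_cast hk
      exact mul_pos (by linarith) hpos
  push_cast at h hsum
  linarith

/-- If `μ` has period `d` and `|t| ≤ π`, the sines of `t * k / (2 * d)` vanish for all `k` in the
support of `μ` only when `t = 0`. -/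
lemma eq_zero_of_forall_sin_eq_zero {μ : ℕ → ℝ} {d : ℕ} (hd : 0 < d)
    (hgcd : ∀ e : ℕ, (∀ k, 1 ≤ k → μ k ≠ 0 → e ∣ k) → e ∣ d) {t : ℝ} (ht : |t| ≤ π)
    (h : ∀ k, 1 ≤ k → μ k ≠ 0 → Real.sin (t * k / (2 * d)) = 0) : t = 0 := by
  have hd' : (d : ℝ) ≠ 0 := by exact_mod_cast hd.ne'
  let H : AddSubgroup ℤ := (AddSubgroup.zmultiples π).comap
    ((AddMonoidHom.mulLeft (t / (2 * d))).comp (Int.castAddHom ℝ))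
  have hH : ∀ k : ℤ, k ∈ H ↔ ∃ n : ℤ, (n : ℝ) * π = t / (2 * d) * k := by
    intro k
    simp [H, AddSubgroup.mem_zmultiples_iff]
  obtain ⟨a, ha⟩ := Int.subgroup_cyclic H
  have hmem : ∀ k : ℤ, k ∈ H ↔ a ∣ k := by
    intro k
    rw [ha, AddSubgroup.mem_closure_singleton]
    simp only [smul_eq_mul]
    exact ⟨fun ⟨z, hz⟩ => ⟨z, by rw [← hz, mul_comm]⟩, fun ⟨z, hz⟩ => ⟨z, by rw [hz, mul_comm]⟩⟩
  have hda : (d : ℤ) ∈ H := by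
    rw [hmem, ← Int.natAbs_dvd, Int.natCast_dvd_natCast]
    refine hgcd _ fun k hk hμ => ?_
    rw [← Int.natCast_dvd_natCast, Int.natAbs_dvd, ← hmem, hH]
    obtain ⟨n, hn⟩ := Real.sin_eq_zero_iff.1 (h k hk hμ)
    exact ⟨n, by rw [hn]; push_cast; ring⟩
  obtain ⟨n, hn⟩ := (hH d).1 hda
  have ht2 : t = 2 * n * π := by
    push_cast at hn
    field_simp at hn
    linarith
  have hn0 : n = 0 := by
    by_contra hn0
    have h1 : (1 : ℝ) ≤ |(n : ℝ)| := by exact_mod_cast Int.one_le_abs hn0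
    rw [ht2, abs_mul, abs_mul, abs_of_pos Real.pi_pos, abs_two] at ht
    nlinarith [Real.pi_pos]
  simpa [hn0] using ht2

lemma exists_norm_stepCharFun_le {μ : ℕ → ℝ} {K d : ℕ} (hμ : H1 μ K) (hd : 0 < d)
    (hgcd : ∀ e : ℕ, (∀ k, 1 ≤ k → μ k ≠ 0 → e ∣ k) → e ∣ d) :
    ∃ c > 0, ∀ t, |t| ≤ π → ‖stepCharFun μ K d t‖ ≤ Real.exp (-c * t ^ 2) := by
  have hd' : (d : ℝ) ≠ 0 := by exact_mod_cast hd.ne'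
  set h : ℝ → ℝ := fun t => ∑ j ∈ Finset.range (K + 1), ∑ k ∈ Finset.range (K + 1),
    μ j * μ k * (((j - k : ℝ) / d) ^ 2 / 2 * Real.sinc (t * ((j - k : ℝ) / d) / 2) ^ 2) with hh
  have hnonneg : ∀ (t : ℝ) (j k : ℕ), 0 ≤ μ j * μ k *
      (((j - k : ℝ) / d) ^ 2 / 2 * Real.sinc (t * ((j - k : ℝ) / d) / 2) ^ 2) := fun t j k =>
    mul_nonneg (mul_nonneg (hμ.1 j) (hμ.1 k)) (by positivity)
  have hnorm : ∀ t, ‖stepCharFun μ K d t‖ ^ 2 = 1 - t ^ 2 * h t := by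
    intro t
    rw [stepCharFun, norm_sq_sum_mul_exp]
    have h1 : ∑ j ∈ Finset.range (K + 1), ∑ k ∈ Finset.range (K + 1), μ j * μ k = 1 := by
      rw [← Finset.sum_mul_sum, sum_range_of_H1 hμ, one_mul]
    refine Eq.trans ?_ (congrArg (fun x => x - t ^ 2 * h t) h1)
    simp only [hh, Finset.mul_sum, ← Finset.sum_sub_distrib]
    refine Finset.sum_congr rfl fun j _ => Finset.sum_congr rfl fun k _ => ?_
    have : t * ((j - 1) / d) - t * ((k - 1) / d) = t * ((j - k : ℝ) / d) := by ring
    rw [this, cos_eq_one_sub_sinc]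
    ring
  have hcont : Continuous h := by
    have := Real.continuous_sinc
    fun_prop
  have hpos : ∀ t, |t| ≤ π → 0 < h t := by
    intro t ht
    refine lt_of_le_of_ne (Finset.sum_nonneg fun j _ => Finset.sum_nonneg fun k _ =>
      hnonneg t j k) fun h0 => ?_
    have hterm : ∀ k, 1 ≤ k → μ k ≠ 0 → Real.sinc (t * (k / d) / 2) = 0 := by
      intro k hk hμk
      have hkK : k ∈ Finset.range (K + 1) := by
        by_contra hK
        exact hμk (hμ.2.2.2.2.2 k (by simpa using hK))
      have h1 := (Finset.sum_eq_zero_iff_of_nonneg (fun j _ => Finset.sum_nonneg fun k _ =>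
        hnonneg t j k)).1 h0.symm k hkK
      have h2 := (Finset.sum_eq_zero_iff_of_nonneg (fun i _ => hnonneg t k i)).1 h1 0 (by simp)
      have hk0 : (k : ℝ) ≠ 0 := by positivity
      have := (zero_pos_of_H1 hμ).ne'
      simpa [hμk, this, hk0, hd'] using h2
    have ht0 : t = 0 := by
      refine eq_zero_of_forall_sin_eq_zero hd hgcd ht fun k hk hμk => ?_
      have h1 := hterm k hk hμk
      rw [Real.sinc_apply] at h1
      split_ifs at h1 with h2
      · exact absurd h1 one_ne_zero
      rw [div_eq_zero_iff] at h1
      rw [show t * k / (2 * d) = t * (k / d) / 2 by ring]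
      exact h1.resolve_right h2
    obtain ⟨k, hk, hμk⟩ := exists_two_le_of_H1 hμ
    simpa [ht0] using hterm k (by omega) hμk.ne'
  obtain ⟨t₀, ht₀, hmin⟩ := isCompact_Icc.exists_isMinOn
    (Set.nonempty_Icc.2 (show -π ≤ π by linarith [Real.pi_pos])) hcont.continuousOn
  refine ⟨h t₀ / 2, half_pos (hpos t₀ (abs_le.2 ht₀)), fun t ht => ?_⟩
  have h1 : h t₀ ≤ h t := hmin (abs_le.1 ht)
  refine le_of_sq_le_sq ?_ (Real.exp_pos _).le
  rw [hnorm, ← Real.exp_nat_mul]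
  have h2 := Real.add_one_le_exp (-(t ^ 2 * h t₀))
  have h3 := mul_le_mul_of_nonneg_left h1 (sq_nonneg t)
  calc 1 - t ^ 2 * h t ≤ Real.exp (-(t ^ 2 * h t₀)) := by linarith
    _ = _ := by
      congr 1
      push_cast
      ring

lemma norm_exp_sub_quadratic_le {z : ℂ} (hz : ‖z‖ ≤ 1) :
    ‖Complex.exp z - 1 - z - z ^ 2 / 2‖ ≤ ‖z‖ ^ 3 := by
  have h := Complex.exp_bound hz (n := 3) (by norm_num)
  have h1 : Complex.exp z - 1 - z - z ^ 2 / 2 =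
      Complex.exp z - ∑ m ∈ Finset.range 3, z ^ m / m.factorial := by
    simp [Finset.sum_range_succ, Nat.factorial]
    ring
  rw [h1]
  refine h.trans (mul_le_of_le_one_right (by positivity) ?_)
  norm_num [Nat.factorial]

lemma tendsto_natCast_mul_exp_sub_one_sub (z : ℂ) :
    Tendsto (fun n : ℕ => (n : ℂ) * (Complex.exp (z / (√n : ℝ)) - 1 - z / (√n : ℝ))) atTop
      (nhds (z ^ 2 / 2)) := by
  have hs : Tendsto (fun n : ℕ => √(n : ℝ)) atTop atTop :=
    Real.tendsto_sqrt_atTop.comp tendsto_natCast_atTop_atTop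
  have h0 : Tendsto (fun n : ℕ => ‖z‖ ^ 3 / √(n : ℝ)) atTop (nhds 0) :=
    tendsto_const_nhds.div_atTop hs
  rw [tendsto_iff_norm_sub_tendsto_zero]
  refine squeeze_zero' (Eventually.of_forall fun _ => norm_nonneg _) ?_ h0
  filter_upwards [hs.eventually_ge_atTop ‖z‖, hs.eventually_gt_atTop 0] with n hn hpos
  set s := √(n : ℝ) with hs'
  have hsq : (n : ℂ) = (s : ℂ) ^ 2 := by
    have : (n : ℝ) = s ^ 2 := (Real.sq_sqrt n.cast_nonneg).symm
    exact_mod_cast this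
  have hs0 : (s : ℂ) ≠ 0 := by exact_mod_cast hpos.ne'
  have hnz : ‖z / (s : ℂ)‖ = ‖z‖ / s := by simp [abs_of_pos hpos]
  have hle : ‖z / (s : ℂ)‖ ≤ 1 := by
    rw [hnz]
    exact div_le_one_of_le₀ hn hpos.le
  have heq : (n : ℂ) * (Complex.exp (z / s) - 1 - z / s) - z ^ 2 / 2 =
      (s : ℂ) ^ 2 * (Complex.exp (z / s) - 1 - z / s - (z / s) ^ 2 / 2) := by
    rw [hsq]
    field_simp
  rw [heq, norm_mul, norm_pow, Complex.norm_real, Real.norm_of_nonneg hpos.le]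
  calc s ^ 2 * _ ≤ s ^ 2 * (‖z‖ / s) ^ 3 := by
        rw [← hnz]
        exact mul_le_mul_of_nonneg_left (norm_exp_sub_quadratic_le hle) (by positivity)
    _ = ‖z‖ ^ 3 / s := by
        field_simp

lemma tendsto_stepCharFun_pow {μ : ℕ → ℝ} {K d : ℕ} (hμ : H1 μ K) (u : ℝ) :
    Tendsto (fun n : ℕ => stepCharFun μ K d (u / √n) ^ n) atTop
      (nhds (Complex.exp (-((gwVar μ / d ^ 2 / 2 : ℝ) : ℂ) * (u : ℂ) ^ 2))) := by
  have hlim : Tendsto (fun n : ℕ => ∑ k ∈ Finset.range (K + 1), (μ k : ℂ) * ((n : ℂ) *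
      (Complex.exp (((u * ((k - 1) / d) : ℝ) : ℂ) * Complex.I / (√n : ℝ)) - 1 -
        ((u * ((k - 1) / d) : ℝ) : ℂ) * Complex.I / (√n : ℝ)))) atTop
      (nhds (∑ k ∈ Finset.range (K + 1),
        (μ k : ℂ) * ((((u * ((k - 1) / d) : ℝ) : ℂ) * Complex.I) ^ 2 / 2))) :=
    tendsto_finsetSum _ fun k _ => (tendsto_natCast_mul_exp_sub_one_sub _).const_mul _
  have hval : ∑ k ∈ Finset.range (K + 1),
      (μ k : ℂ) * ((((u * ((k - 1) / d) : ℝ) : ℂ) * Complex.I) ^ 2 / 2) =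
      -((gwVar μ / d ^ 2 / 2 : ℝ) : ℂ) * (u : ℂ) ^ 2 := by
    rw [gwVar_eq_sum hμ.2.2.2.2.2]
    push_cast
    simp only [Finset.sum_div, Finset.sum_mul, ← Finset.sum_neg_distrib]
    refine Finset.sum_congr rfl fun k _ => ?_
    rw [mul_pow, Complex.I_sq]
    ring
  rw [hval] at hlim
  have hg : ∀ n : ℕ, ∑ k ∈ Finset.range (K + 1), (μ k : ℂ) * ((n : ℂ) *
      (Complex.exp (((u * ((k - 1) / d) : ℝ) : ℂ) * Complex.I / (√n : ℝ)) - 1 -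
        ((u * ((k - 1) / d) : ℝ) : ℂ) * Complex.I / (√n : ℝ))) =
      n * (stepCharFun μ K d (u / √n) - 1) := by
    intro n
    have h0 : ∑ k ∈ Finset.range (K + 1), (μ k : ℂ) *
        (((u * ((k - 1) / d) : ℝ) : ℂ) * Complex.I / (√n : ℝ)) = 0 := by
      have h : (∑ k ∈ Finset.range (K + 1), ((k : ℂ) - 1) * (μ k : ℂ)) = 0 := by
        exact_mod_cast congrArg (fun x : ℝ => (x : ℂ)) (sum_range_sub_one_mul_of_H1 hμ)
      rw [← mul_zero ((u : ℂ) / d * Complex.I / (√n : ℝ)), ← h, Finset.mul_sum]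
      refine Finset.sum_congr rfl fun k _ => ?_
      push_cast
      ring
    have h1 : ∑ k ∈ Finset.range (K + 1), (μ k : ℂ) = 1 := by
      exact_mod_cast congrArg (fun x : ℝ => (x : ℂ)) (sum_range_of_H1 hμ)
    have hexp : ∀ k : ℕ, ((u * ((k - 1) / d) : ℝ) : ℂ) * Complex.I / (√n : ℝ) =
        ((u / √n * ((k - 1) / d) : ℝ) : ℂ) * Complex.I := by
      intro k
      push_cast
      ring
    simp only [mul_left_comm _ (n : ℂ), ← Finset.mul_sum]
    simp only [mul_sub, Finset.sum_sub_distrib, h0, mul_one, h1, sub_zero]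
    simp only [hexp, stepCharFun]
  simp only [hg] at hlim
  refine (Complex.tendsto_one_add_pow_exp_of_tendsto hlim).congr fun n => ?_
  rw [add_sub_cancel]

/-- Laplace's method for powers of a characteristic function with Gaussian decay. -/
lemma tendsto_sqrt_mul_integral_pow {f g : ℝ → ℂ} {c v : ℝ} (hc : 0 < c)
    (hf : Continuous f) (hg : Continuous g) (hg0 : g 0 = 1) (hg1 : ∀ t, ‖g t‖ ≤ 1)
    (hbound : ∀ t, |t| ≤ π → ‖f t‖ ≤ Real.exp (-c * t ^ 2))
    (hlim : ∀ u : ℝ, Tendsto (fun n : ℕ => f (u / √n) ^ n) atTop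
      (nhds (Complex.exp (-(v : ℂ) * (u : ℂ) ^ 2)))) :
    Tendsto (fun n : ℕ => (√n : ℂ) * ∫ t in (-π)..π, g t * f t ^ n) atTop
      (nhds (√(π / v) : ℝ)) := by
  have hs : Tendsto (fun n : ℕ => √(n : ℝ)) atTop atTop :=
    Real.tendsto_sqrt_atTop.comp tendsto_natCast_atTop_atTop
  have hcov : ∀ n : ℕ, (√n : ℂ) * ∫ t in (-π)..π, g t * f t ^ n =
      ∫ u : ℝ, (Set.Ioc (-π) π).indicator (fun t => g t * f t ^ n) (u / √n) := by
    intro n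
    rw [Measure.integral_comp_div, integral_indicator measurableSet_Ioc,
      intervalIntegral.integral_of_le (by linarith [Real.pi_pos]), Complex.real_smul,
      abs_of_nonneg (Real.sqrt_nonneg _)]
  have hgauss : ∫ u : ℝ, Complex.exp (-(v : ℂ) * (u : ℂ) ^ 2) = (√(π / v) : ℝ) := by
    rw [← integral_gaussian v, ← integral_complex_ofReal]
    push_cast
    rfl
  simp only [hcov]
  rw [← hgauss]
  refine tendsto_integral_filter_of_dominated_convergence (fun u => Real.exp (-c * u ^ 2))
    (Eventually.of_forall fun n => ?_) ?_ (integrable_exp_neg_mul_sq hc)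
    (Eventually.of_forall fun u => ?_)
  · have hm : Measurable ((Set.Ioc (-π) π).indicator (fun t => g t * f t ^ n)) :=
      (hg.mul (hf.pow n)).measurable.indicator measurableSet_Ioc
    exact (hm.comp (measurable_id.div_const _)).aestronglyMeasurable
  · filter_upwards [eventually_gt_atTop 0] with n hn
    refine Eventually.of_forall fun u => ?_
    by_cases hu : u / √n ∈ Set.Ioc (-π) π
    · rw [Set.indicator_of_mem hu, norm_mul, norm_pow]
      have hb := hbound (u / √n) (abs_le.2 ⟨hu.1.le, hu.2⟩)
      calc _ ≤ 1 * Real.exp (-c * (u / √n) ^ 2) ^ n := by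
            gcongr
            exact hg1 _
        _ = Real.exp (-c * u ^ 2) := by
            have : (n : ℝ) ≠ 0 := by positivity
            rw [one_mul, ← Real.exp_nat_mul, div_pow, Real.sq_sqrt n.cast_nonneg]
            congr 1
            field_simp
    · rw [Set.indicator_of_notMem hu, norm_zero]
      exact (Real.exp_pos _).le
  · have hu0 : Tendsto (fun n : ℕ => u / √(n : ℝ)) atTop (nhds 0) :=
      tendsto_const_nhds.div_atTop hs
    have hg' : Tendsto (fun n : ℕ => g (u / √n)) atTop (nhds 1) := by
      rw [← hg0]
      exact (hg.tendsto 0).comp hu0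
    have := hg'.mul (hlim u)
    rw [one_mul] at this
    refine this.congr' ?_
    filter_upwards [hu0.eventually_mem (Ioc_mem_nhds (neg_lt_zero.2 Real.pi_pos) Real.pi_pos)]
      with n hn
    rw [Set.indicator_of_mem hn]

/-- Assume (H1); let `σ_μ² = gwVar μ` and `d = gcd{k ≥ 1 : μ_k > 0}`.  Then, along
the subsequence `n ∈ 1 + dℕ` (the support of `|𝐓|`),
`P(|𝐓| = n) ∼ d n^{-3/2}/(√(2π) σ_μ)`, i.e.
`n^{3/2} P(|𝐓| = n) → d/(√(2π) σ_μ)`. -/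
theorem statement7
    (μ : ℕ → ℝ) (K : ℕ) (hμ : H1 μ K) (d : ℕ)
    (hd1 : 0 < d)
    (hd2 : ∀ k, 1 ≤ k → μ k ≠ 0 → d ∣ k)
    (hd3 : ∀ e : ℕ, (∀ k, 1 ≤ k → μ k ≠ 0 → e ∣ k) → e ∣ d) :
    Tendsto
      (fun m : ℕ => ((1 + d * m : ℕ) : ℝ) ^ ((3 : ℝ) / 2) * treeSizeProb μ (1 + d * m))
      atTop
      (nhds ((d : ℝ) / (Real.sqrt (2 * π) * Real.sqrt (gwVar μ)))) := by
  have hK := hμ.2.2.2.2.2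
  have hd0 : (d : ℝ) ≠ 0 := by exact_mod_cast hd1.ne'
  obtain ⟨c, hc, hbound⟩ := exists_norm_stepCharFun_le hμ hd1 hd3
  have hlim := tendsto_sqrt_mul_integral_pow (g := fun t =>
      Complex.exp (((t / d : ℝ) : ℂ) * Complex.I)) hc (continuous_stepCharFun μ K d)
    (by fun_prop) (by simp) (fun t => (Complex.norm_exp_ofReal_mul_I _).le) hbound
    (fun u => tendsto_stepCharFun_pow hμ u)
  have hsub : Tendsto (fun m : ℕ => 1 + d * m) atTop atTop :=
    tendsto_atTop_mono (fun m => show m ≤ 1 + d * m by nlinarith) tendsto_id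
  have hcoeff : Tendsto (fun m : ℕ => √((1 + d * m : ℕ) : ℝ) *
      (offspringPoly μ K ^ (1 + d * m)).coeff (d * m)) atTop
      (nhds (√(π / (gwVar μ / d ^ 2 / 2)) / (2 * π))) := by
    have h := (Complex.continuous_re.tendsto _).comp ((hlim.comp hsub).div_const (2 * π : ℂ))
    have hval : ((√(π / (gwVar μ / d ^ 2 / 2)) : ℝ) / (2 * π : ℂ)).re =
        √(π / (gwVar μ / d ^ 2 / 2)) / (2 * π) := by
      exact_mod_cast Complex.ofReal_re _
    rw [hval] at h
    refine h.congr fun m => ?_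
    simp only [Function.comp_apply, ← coeff_offspringPoly_pow hK hd1 hd2]
    rw [mul_left_comm, mul_div_cancel_left₀ _ (by simp), ← Complex.ofReal_mul,
      Complex.ofReal_re]
  have hconst : √(π / (gwVar μ / d ^ 2 / 2)) / (2 * π) =
      (d : ℝ) / (Real.sqrt (2 * π) * Real.sqrt (gwVar μ)) := by
    have hpi := Real.pi_pos
    have hvar := gwVar_pos hμ
    have h1 : π / (gwVar μ / d ^ 2 / 2) = (2 * π) * d ^ 2 / gwVar μ := by
      field_simp
    rw [h1, Real.sqrt_div (by positivity), Real.sqrt_mul (by positivity),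
      Real.sqrt_sq (Nat.cast_nonneg d)]
    have h2 : √(2 * π) ^ 2 = 2 * π := Real.sq_sqrt (by positivity)
    have h3 : √(2 * π) ≠ 0 := by positivity
    have h4 : √(gwVar μ) ≠ 0 := by positivity
    rw [div_div, div_eq_div_iff (by positivity) (by positivity)]
    linear_combination (d : ℝ) * √(gwVar μ) * h2
  rw [← hconst]
  refine hcoeff.congr fun m => ?_
  have hdwass := succ_mul_treeSizeProb_succ hK (d * m)
  have hn : (0 : ℝ) < ((1 + d * m : ℕ) : ℝ) := by positivity
  rw [add_comm 1 (d * m)] at hn ⊢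
  rw [← hdwass, show ((3 : ℝ) / 2) = 1 / 2 + 1 by norm_num, Real.rpow_add hn, Real.rpow_one,
    ← Real.sqrt_eq_rpow]
  push_cast
  ring

end
end

section
/- Assume (H1). For any c > 0 there exists ρ > 0 such that P_n( max over 0 ≤ l < n of | |u(l+1)| − |u(l)| | ≥ ρ log n ) = O(n^{−c}) as n → ∞ (along the subsequence of n for which P_n is defined). -/
open scoped Classical
open Filter
noncomputable section

/-- `P_n(S) = P(S | |𝐓| = n+1)` : the Galton-Watson measure conditioned to have `n`
edges (`n+1` vertices). -/
def condProb (μ : ℕ → ℝ) (n : ℕ) (S : Set PlanarTree) : ℝ :=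
  gwProb μ (S ∩ {T | T.val.card = n + 1}) / treeSizeProb μ (n + 1)

/-- `u(k)`, the `(k+1)`-st vertex of `T` in the lexicographical (depth-first) order
(`[]`-junk value if `k` exceeds the number of vertices). -/
def vertexAt (T : PlanarTree) (k : ℕ) : List ℕ :=
  (T.val.sort (· ≤ ·)).getD k []

/-- `s` lies strictly to the left of `t`, neither being an ancestor of the other. -/
def LeftOf (s t : List ℕ) : Prop :=
  ∃ p i j a b, i < j ∧ s = p ++ i :: a ∧ t = p ++ j :: b

theorem LeftOf.mono {s t s' t' : List ℕ} (h : LeftOf s t) (hs : s <+: s') (ht : t <+: t') :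
    LeftOf s' t' := by
  obtain ⟨p, i, j, a, b, hij, rfl, rfl⟩ := h
  obtain ⟨c, rfl⟩ := hs
  obtain ⟨d, rfl⟩ := ht
  exact ⟨p, i, j, a ++ c, b ++ d, hij, by simp, by simp⟩

theorem LeftOf.lt {s t : List ℕ} (h : LeftOf s t) : s < t := by
  obtain ⟨p, i, j, a, b, hij, rfl, rfl⟩ := h
  induction p with
  | nil => exact List.Lex.rel hij
  | cons x p ih => exact List.Lex.cons ih

theorem List.IsPrefix.le_lex {s t : List ℕ} (h : s <+: t) : s ≤ t :=
  not_lt.1 fun h' => h.le h'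

theorem LeftOf.not_prefix {s t : List ℕ} (h : LeftOf s t) : ¬ t <+: s := fun hp =>
  lt_irrefl _ (h.mono (List.prefix_refl s) hp).lt

/-- The first `k` potential children of the vertex `u`. -/
def children (u : List ℕ) (k : ℕ) : List (List ℕ) :=
  (List.range k).map fun i => u ++ [i + 1]

theorem mem_children {u v : List ℕ} {k : ℕ} :
    v ∈ children u k ↔ ∃ i, 1 ≤ i ∧ i ≤ k ∧ v = u ++ [i] := by
  simp only [children, List.mem_map, List.mem_range]
  constructor
  · rintro ⟨i, hi, rfl⟩
    exact ⟨i + 1, by omega, by omega, rfl⟩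
  · rintro ⟨i, h1, h2, rfl⟩
    exact ⟨i - 1, by omega, by rw [Nat.sub_add_cancel h1]⟩

@[simp] theorem length_children (u : List ℕ) (k : ℕ) : (children u k).length = k := by
  simp [children]

theorem pairwise_leftOf_children {u : List ℕ} {st : List (List ℕ)} (k : ℕ)
    (h : (u :: st).Pairwise LeftOf) : (children u k ++ st).Pairwise LeftOf := by
  rw [List.pairwise_cons] at h
  rw [List.pairwise_append]
  refine ⟨?_, h.2, ?_⟩
  · rw [children, List.pairwise_map]
    exact List.pairwise_lt_range.imp fun {i j} hij =>
      ⟨u, i + 1, j + 1, [], [], by omega, rfl, rfl⟩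
  · intro a ha b hb
    obtain ⟨i, -, -, rfl⟩ := mem_children.1 ha
    exact (h.1 b hb).mono (List.prefix_append _ _) (List.prefix_refl _)

/-- Depth-first exploration of the forest whose pending vertices are listed in the stack, the
successive numbers of children being read from a word. -/
def dfs : List ℕ → List (List ℕ) → List (List ℕ)
  | k :: w, u :: st => u :: dfs w (children u k ++ st)
  | _, _ => []

/-- Reading the word of numbers of children leads from `h` to `h'` pending vertices, with at
least one pending vertex available at each step. -/
def Run : ℕ → List ℕ → ℕ → Prop
  | h, [], h' => h = h'
  | h, k :: w, h' => 1 ≤ h ∧ Run (h - 1 + k) w h'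

theorem Run.append {h a b : ℕ} {u v : List ℕ} (hu : Run h u a) (hv : Run a v b) :
    Run h (u ++ v) b := by
  induction u generalizing h with
  | nil => obtain rfl : h = a := hu; exact hv
  | cons k u ih => exact ⟨hu.1, ih hu.2⟩

theorem Run.add_right {h a : ℕ} {u : List ℕ} (hu : Run h u a) (c : ℕ) :
    Run (h + c) u (a + c) := by
  induction u generalizing h with
  | nil => obtain rfl : h = a := hu; rfl
  | cons k u ih =>
    refine ⟨hu.1.trans (by omega), ?_⟩
    have h1 := hu.1
    have := ih hu.2
    rwa [show h - 1 + k + c = h + c - 1 + k by omega] at this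

theorem Run.sum_eq {h a : ℕ} {u : List ℕ} (hu : Run h u a) : h + u.sum = a + u.length := by
  induction u generalizing h with
  | nil => obtain rfl : h = a := hu; simp
  | cons k u ih =>
    have h1 := hu.1
    have := ih hu.2
    simp only [List.sum_cons, List.length_cons]
    omega

theorem exists_run_split (w : List ℕ) :
    ∃ u v m j, w = u ++ v ∧ Run m u 0 ∧ Run 1 v (1 + j) := by
  induction w with
  | nil => exact ⟨[], [], 0, 0, rfl, rfl, rfl⟩
  | cons k w ih =>
    obtain ⟨u, v, m, j, rfl, hu, hv⟩ := ih
    by_cases hk : k ≤ m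
    · refine ⟨k :: u, v, m - k + 1, j, rfl, ⟨by omega, ?_⟩, hv⟩
      rwa [show m - k + 1 - 1 + k = m by omega]
    · refine ⟨[], k :: (u ++ v), 0, j + (k - m - 1), rfl, rfl, le_refl _, ?_⟩
      have h1 := hu.add_right (k - m)
      have h2 := hv.add_right (k - m - 1)
      rw [show m + (k - m) = 1 - 1 + k by omega, zero_add] at h1
      rw [show 1 + (k - m - 1) = k - m by omega,
        show 1 + j + (k - m - 1) = 1 + (j + (k - m - 1)) by omega] at h2
      exact h1.append h2

/-- Cycle lemma: a word of total increment `-1` has a rotation coding a tree. -/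
theorem exists_rotate_run {w : List ℕ} (hw : w.sum + 1 = w.length) :
    ∃ r < w.length, Run 1 (w.rotate r) 0 := by
  obtain ⟨u, v, m, j, rfl, hu, hv⟩ := exists_run_split w
  have h1 := hu.sum_eq
  have h2 := hv.sum_eq
  simp only [List.sum_append, List.length_append] at hw
  obtain rfl : 1 + j = m := by omega
  have key : Run 1 (v ++ u) 0 := hv.append hu
  rcases Nat.lt_or_ge u.length (u ++ v).length with h | h
  · exact ⟨u.length, h, by rwa [List.rotate_append_length_eq]⟩
  · have : v = [] := by
      rw [List.length_append] at h
      exact List.length_eq_zero_iff.1 (by omega)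
    subst this
    exact ⟨0, by simp only [List.length_append]; omega, by simpa using key⟩

theorem snoc_mem_iff {T : Finset (List ℕ)} (hT : IsPlanarTree T) (u : List ℕ) (i : ℕ) :
    u ++ [i] ∈ T ↔ 1 ≤ i ∧ i ≤ numChildren T u := by
  have hfin : {i | u ++ [i] ∈ T}.Finite :=
    Set.Finite.preimage (f := fun i => u ++ [i]) (fun a _ b _ h => by simpa using h)
      T.finite_toSet
  set I := hfin.toFinset with hI
  have hmem : ∀ i, i ∈ I ↔ u ++ [i] ∈ T := by simp [hI]
  have hIcc : I = Finset.Icc 1 (I.sup id) := by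
    ext i
    rw [Finset.mem_Icc]
    refine ⟨fun h => ⟨(hT.2 u i ((hmem i).1 h)).1, Finset.le_sup (f := id) h⟩, ?_⟩
    rintro ⟨h1, h2⟩
    obtain ⟨m, hm, hm'⟩ := Finset.exists_mem_eq_sup I
      (Finset.nonempty_iff_ne_empty.2 fun h => by
        rw [h, Finset.sup_empty, bot_eq_zero] at h2; omega) id
    rw [hm'] at h2
    exact (hmem i).2 ((hT.2 u m ((hmem m).1 hm)).2.2 i h1 h2)
  have hcard : numChildren T u = I.card := by
    rw [numChildren, ← Finset.card_image_of_injective I (f := fun i => u ++ [i])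
      (fun a b h => by simpa using h)]
    congr 1
    ext v
    simp only [Finset.mem_filter, Finset.mem_image, hmem]
    constructor
    · rintro ⟨hv, i, rfl⟩
      exact ⟨i, hv, rfl⟩
    · rintro ⟨i, hi, rfl⟩
      exact ⟨hi, i, rfl⟩
  rw [← hmem, hcard]
  have : I.card = I.sup id := by
    conv_lhs => rw [hIcc]
    simp
  rw [this]
  conv_lhs => rw [hIcc]
  rw [Finset.mem_Icc]

theorem prefix_cases {u v : List ℕ} (h : u <+: v) : v = u ∨ ∃ i, u ++ [i] <+: v := by
  obtain ⟨c, rfl⟩ := h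
  cases c with
  | nil => exact Or.inl (by simp)
  | cons i c => exact Or.inr ⟨i, c, by simp⟩

theorem IsPlanarTree.mem_of_prefix {T : Finset (List ℕ)} (hT : IsPlanarTree T) {u v : List ℕ}
    (h : u <+: v) (hv : v ∈ T) : u ∈ T := by
  obtain ⟨c, rfl⟩ := h
  induction c using List.reverseRecOn with
  | nil => simpa using hv
  | append_singleton c i ih =>
    rw [← List.append_assoc] at hv
    exact ih (hT.2 _ _ hv).2.1

theorem dfs_eq_of_forest {T : Finset (List ℕ)} (hT : IsPlanarTree T) (R S : List (List ℕ))
    (hS : S.Pairwise LeftOf) (hR : R.Pairwise (· < ·))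
    (hmem : ∀ v, v ∈ R ↔ v ∈ T ∧ ∃ s ∈ S, s <+: v) (hST : ∀ s ∈ S, s ∈ T) :
    dfs (R.map (numChildren T)) S = R ∧ Run S.length (R.map (numChildren T)) 0 := by
  induction R generalizing S with
  | nil =>
    cases S with
    | nil => exact ⟨rfl, rfl⟩
    | cons s S =>
      exact absurd ((hmem s).2 ⟨hST s (by simp), s, by simp, List.prefix_refl s⟩) (by simp)
  | cons x R ih =>
    cases S with
    | nil => simpa using (hmem x).1 (by simp)
    | cons u st =>
      have hSc := List.pairwise_cons.1 hS
      have hRc := List.pairwise_cons.1 hR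
      obtain rfl : u = x := by
        apply le_antisymm
        · obtain ⟨-, s, hs, hsx⟩ := (hmem x).1 (by simp)
          rcases List.mem_cons.1 hs with rfl | hs
          · exact hsx.le_lex
          · exact (hSc.1 s hs).lt.le.trans hsx.le_lex
        · have : u ∈ x :: R := (hmem u).2 ⟨hST u (by simp), u, by simp, List.prefix_refl u⟩
          rcases List.mem_cons.1 this with rfl | h
          · exact le_rfl
          · exact (hRc.1 u h).le
      have huT : u ∈ T := hST u (by simp)
      have := ih (children u (numChildren T u) ++ st) (pairwise_leftOf_children _ hS) hRc.2 ?_ ?_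
      · refine ⟨?_, ?_⟩
        · rw [List.map_cons, dfs, this.1]
        · refine ⟨by simp, ?_⟩
          have h2 := this.2
          rw [List.length_append, length_children] at h2
          rwa [show (u :: st).length - 1 + numChildren T u = numChildren T u + st.length by
            simp; omega]
      · intro v
        constructor
        · intro hv
          obtain ⟨hvT, s, hs, hsv⟩ := (hmem v).1 (List.mem_cons_of_mem _ hv)
          refine ⟨hvT, ?_⟩
          rcases List.mem_cons.1 hs with rfl | hs
          · rcases prefix_cases hsv with rfl | ⟨i, hi⟩
            · exact absurd (hRc.1 _ hv) (lt_irrefl _)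
            · have := (snoc_mem_iff hT s i).1 (hT.mem_of_prefix hi hvT)
              exact ⟨s ++ [i], List.mem_append_left _
                (mem_children.2 ⟨i, this.1, this.2, rfl⟩), hi⟩
          · exact ⟨s, List.mem_append_right _ hs, hsv⟩
        · rintro ⟨hvT, s, hs, hsv⟩
          have hne : ¬ v <+: u := by
            intro hvu
            rcases List.mem_append.1 hs with hs | hs
            · obtain ⟨i, -, -, rfl⟩ := mem_children.1 hs
              have := (hsv.trans hvu).length_le
              simp at this
            · exact (hSc.1 s hs).not_prefix (hsv.trans hvu)
          have : v ∈ u :: R := by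
            refine (hmem v).2 ⟨hvT, ?_⟩
            rcases List.mem_append.1 hs with hs | hs
            · obtain ⟨i, -, -, rfl⟩ := mem_children.1 hs
              exact ⟨u, by simp, (List.prefix_append _ _).trans hsv⟩
            · exact ⟨s, by simp [hs], hsv⟩
          rcases List.mem_cons.1 this with rfl | h
          · exact absurd (List.prefix_refl _) hne
          · exact h
      · intro s hs
        rcases List.mem_append.1 hs with hs | hs
        · obtain ⟨i, h1, h2, rfl⟩ := mem_children.1 hs
          exact (snoc_mem_iff hT u i).2 ⟨h1, h2⟩
        · exact hST s (by simp [hs])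

/-- The vertices of a tree in lexicographical order. -/
def vertexList (T : PlanarTree) : List (List ℕ) := T.val.sort (· ≤ ·)

/-- The numbers of children of the vertices of a tree, in lexicographical order. -/
def degreeWord (T : PlanarTree) : List ℕ := (vertexList T).map (numChildren T.val)

theorem dfs_degreeWord (T : PlanarTree) :
    dfs (degreeWord T) [[]] = vertexList T ∧ Run 1 (degreeWord T) 0 := by
  refine dfs_eq_of_forest T.2 _ [[]] (by simp) ?_ ?_ ?_
  · exact Finset.sortedLT_sort _ |>.pairwise
  · intro v
    simp [vertexList]
  · simpa using T.2.1

theorem length_degreeWord (T : PlanarTree) : (degreeWord T).length = T.val.card := by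
  simp [degreeWord, vertexList]

theorem degreeWord_injective : Function.Injective degreeWord := by
  intro T T' h
  have h1 : vertexList T = vertexList T' := by
    rw [← (dfs_degreeWord T).1, ← (dfs_degreeWord T').1, h]
  apply Subtype.ext
  rw [← Finset.sort_toFinset T.val (· ≤ ·), ← Finset.sort_toFinset T'.val (· ≤ ·)]
  exact congrArg List.toFinset h1

theorem gwWeight_eq_prod (μ : ℕ → ℝ) (T : PlanarTree) :
    gwWeight μ T.val = ((degreeWord T).map μ).prod := by
  rw [degreeWord, vertexList, List.map_map, gwWeight, ← Finset.prod_map_toList]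
  exact ((Finset.sort_perm_toList T.val (· ≤ ·)).map _).prod_eq.symm

theorem dfs_spec (w : List ℕ) (S : List (List ℕ)) (hS : S.Pairwise LeftOf)
    (hw : Run S.length w 0) :
    (dfs w S).length = w.length ∧ (dfs w S).Pairwise (· < ·) ∧
      (∀ v ∈ dfs w S, ∃ s ∈ S, s <+: v) ∧ (∀ s ∈ S, s ∈ dfs w S) ∧
      (∀ v ∈ dfs w S, v ∈ S ∨ ∃ u ∈ dfs w S, ∃ j, v = u ++ [j]) ∧
      ∀ p ∈ (dfs w S).zip w, ∀ j, p.1 ++ [j] ∈ dfs w S ↔ 1 ≤ j ∧ j ≤ p.2 := by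
  induction w generalizing S with
  | nil =>
    obtain rfl : S = [] := List.length_eq_zero_iff.1 hw
    simp [dfs]
  | cons k w ih =>
    cases S with
    | nil => exact absurd hw.1 (by simp)
    | cons u st =>
      have hSc := List.pairwise_cons.1 hS
      obtain ⟨hlen, hlt, hpre, hsub, hpar, hch⟩ := ih (children u k ++ st)
        (pairwise_leftOf_children k hS) (by
          have := hw.2
          rw [List.length_append, length_children]
          rwa [show (u :: st).length - 1 + k = k + st.length by simp; omega] at this)
      have hult : ∀ v ∈ dfs w (children u k ++ st), u < v := by
        intro v hv
        obtain ⟨s, hs, hsv⟩ := hpre v hv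
        refine lt_of_lt_of_le ?_ hsv.le_lex
        rcases List.mem_append.1 hs with hs | hs
        · obtain ⟨i, -, -, rfl⟩ := mem_children.1 hs
          exact lt_of_le_of_ne (List.prefix_append u [i]).le_lex (by simp)
        · exact (hSc.1 s hs).lt
      simp only [dfs]
      refine ⟨by simp [hlen], List.pairwise_cons.2 ⟨hult, hlt⟩, ?_, ?_, ?_, ?_⟩
      · intro v hv
        rcases List.mem_cons.1 hv with rfl | hv
        · exact ⟨v, by simp, List.prefix_refl v⟩
        · obtain ⟨s, hs, hsv⟩ := hpre v hv
          rcases List.mem_append.1 hs with hs | hs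
          · obtain ⟨i, -, -, rfl⟩ := mem_children.1 hs
            exact ⟨u, by simp, (List.prefix_append u [i]).trans hsv⟩
          · exact ⟨s, by simp [hs], hsv⟩
      · intro s hs
        rcases List.mem_cons.1 hs with rfl | hs
        · simp
        · exact List.mem_cons_of_mem _ (hsub s (by simp [hs]))
      · intro v hv
        rcases List.mem_cons.1 hv with rfl | hv
        · exact Or.inl (by simp)
        · rcases hpar v hv with hv | ⟨u', hu', j, rfl⟩
          · rcases List.mem_append.1 hv with hv | hv
            · obtain ⟨i, -, -, rfl⟩ := mem_children.1 hv
              exact Or.inr ⟨u, by simp, i, rfl⟩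
            · exact Or.inl (by simp [hv])
          · exact Or.inr ⟨u', by simp [hu'], j, rfl⟩
      · intro p hp j
        rw [List.zip_cons_cons] at hp
        rcases List.mem_cons.1 hp with rfl | hp
        · constructor
          · intro h
            rcases List.mem_cons.1 h with h | h
            · simp at h
            · obtain ⟨s, hs, hsv⟩ := hpre _ h
              rcases List.mem_append.1 hs with hs | hs
              · obtain ⟨i, h1, h2, rfl⟩ := mem_children.1 hs
                have := hsv.eq_of_length (by simp)
                simp only [List.append_cancel_left_eq, List.cons.injEq, and_true] at this
                exact this ▸ ⟨h1, h2⟩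
              · exact absurd hsv ((hSc.1 s hs).mono (List.prefix_append u [j])
                  (List.prefix_refl s)).not_prefix
          · rintro ⟨h1, h2⟩
            exact List.mem_cons_of_mem _ (hsub _ (List.mem_append_left _
              (mem_children.2 ⟨j, h1, h2, rfl⟩)))
        · rw [← hch p hp j, List.mem_cons, or_iff_right]
          intro h
          have h1 := hult p.1 (List.of_mem_zip hp).1
          have h2 : p.1 ≤ u := h ▸ (List.prefix_append p.1 [j]).le_lex
          exact absurd h1 (not_lt.2 h2)

/-- Every word satisfying the Łukasiewicz condition is the degree word of a tree. -/
theorem exists_degreeWord_eq {w : List ℕ} (hw : Run 1 w 0) :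
    ∃ T : PlanarTree, degreeWord T = w := by
  obtain ⟨hlen, hlt, -, hsub, hpar, hch⟩ := dfs_spec w [[]] (by simp) hw
  set R := dfs w [[]] with hR
  have hzip : ∀ u ∈ R, ∃ k, (u, k) ∈ R.zip w := by
    intro u hu
    obtain ⟨i, hi, rfl⟩ := List.mem_iff_getElem.1 hu
    exact ⟨w[i], List.mem_iff_getElem.2 ⟨i, by simp [hlen]; omega, by simp⟩⟩
  have hT : IsPlanarTree R.toFinset := by
    refine ⟨by simpa using hsub [] (by simp), ?_⟩
    intro u i hui
    rw [List.mem_toFinset] at hui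
    rcases hpar _ hui with h | ⟨u', hu', j, h⟩
    · simp at h
    · obtain rfl : u = u' := (List.append_inj' h rfl).1
      obtain ⟨k, hk⟩ := hzip u hu'
      have := (hch _ hk i).1 hui
      refine ⟨this.1, by simpa using hu', fun j h1 h2 => ?_⟩
      rw [List.mem_toFinset]
      exact (hch _ hk j).2 ⟨h1, h2.trans this.2⟩
  have hnum : ∀ p ∈ R.zip w, numChildren R.toFinset p.1 = p.2 := by
    intro p hp
    have key : ∀ j, (1 ≤ j ∧ j ≤ numChildren R.toFinset p.1) ↔ (1 ≤ j ∧ j ≤ p.2) := by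
      intro j
      rw [← snoc_mem_iff hT, List.mem_toFinset]
      exact hch p hp j
    have h1 := key (numChildren R.toFinset p.1)
    have h2 := key p.2
    omega
  refine ⟨⟨R.toFinset, hT⟩, ?_⟩
  have hsort : vertexList ⟨R.toFinset, hT⟩ = R :=
    (List.toFinset_sort (· ≤ ·) (hlt.imp fun h => ne_of_lt h)).2 (hlt.imp fun h => le_of_lt h)
  change (vertexList ⟨R.toFinset, hT⟩).map (numChildren R.toFinset) = w
  rw [hsort]
  refine List.ext_getElem (by simp [hlen]) fun i h1 h2 => ?_
  rw [List.getElem_map]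
  rw [List.length_map] at h1
  exact hnum (R[i], w[i]) (List.mem_iff_getElem.2 ⟨i, by simp; omega, by simp⟩)

/-- Words of length `N` over the alphabet `{0, ..., K}`. -/
def words (K : ℕ) : ℕ → Finset (List ℕ)
  | 0 => {[]}
  | N + 1 => (Finset.range (K + 1) ×ˢ words K N).image fun p => p.1 :: p.2

theorem mem_words {K N : ℕ} {w : List ℕ} :
    w ∈ words K N ↔ w.length = N ∧ ∀ k ∈ w, k ≤ K := by
  induction N generalizing w with
  | zero => simp +contextual [words, List.length_eq_zero_iff]
  | succ N ih =>
    cases w with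
    | nil => simp [words]
    | cons k w =>
      simp only [words, Finset.mem_image, Finset.mem_product, Finset.mem_range, Prod.exists, ih,
        List.cons.injEq, List.length_cons, List.mem_cons, forall_eq_or_imp, Nat.lt_succ_iff]
      constructor
      · rintro ⟨a, b, ⟨h1, h2, h3⟩, rfl, rfl⟩
        exact ⟨by omega, h1, h3⟩
      · rintro ⟨h1, h2, h3⟩
        exact ⟨k, w, ⟨h2, by omega, h3⟩, rfl, rfl⟩

theorem sum_words_succ {M : Type*} [AddCommMonoid M] (K N : ℕ) (F : List ℕ → M) :
    ∑ w ∈ words K (N + 1), F w =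
      ∑ k ∈ Finset.range (K + 1), ∑ w ∈ words K N, F (k :: w) := by
  rw [words, Finset.sum_image (fun p _ q _ h => by
    rw [List.cons.injEq] at h; exact Prod.ext h.1 h.2), Finset.sum_product]

theorem sum_words_prod {μ : ℕ → ℝ} {K : ℕ} (hμ : ∑ k ∈ Finset.range (K + 1), μ k = 1) (N : ℕ) :
    ∑ w ∈ words K N, (w.map μ).prod = 1 := by
  induction N with
  | zero => simp [words]
  | succ N ih =>
    rw [sum_words_succ]
    simp only [List.map_cons, List.prod_cons, ← Finset.mul_sum, ih, mul_one, hμ]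

/-- The exponential gap between the depths of the first two vertices of a stack. -/
def topGap (x : ℝ) (u : List ℕ) : List (List ℕ) → ℝ
  | v :: _ => x ^ (u.length - v.length)
  | [] => 0

/-- Sum of the exponential gaps between the depths of consecutive vertices of a stack. -/
def gapPotential (x : ℝ) : List (List ℕ) → ℝ
  | u :: st => topGap x u st + gapPotential x st
  | [] => 0

/-- Sum of the gap potentials of the stacks met along the exploration. -/
def totalPotential (x : ℝ) : List ℕ → List (List ℕ) → ℝ
  | k :: w, u :: st => gapPotential x (u :: st) + totalPotential x w (children u k ++ st)
  | _, _ => 0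

theorem topGap_nonneg {x : ℝ} (hx : 0 ≤ x) (u : List ℕ) (st : List (List ℕ)) :
    0 ≤ topGap x u st := by
  cases st with
  | nil => exact le_rfl
  | cons v st => exact pow_nonneg hx _

theorem gapPotential_nonneg {x : ℝ} (hx : 0 ≤ x) (st : List (List ℕ)) :
    0 ≤ gapPotential x st := by
  induction st with
  | nil => exact le_rfl
  | cons u st ih => exact add_nonneg (topGap_nonneg hx _ _) ih

theorem totalPotential_nonneg {x : ℝ} (hx : 0 ≤ x) (w : List ℕ) (st : List (List ℕ)) :
    0 ≤ totalPotential x w st := by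
  induction w generalizing st with
  | nil => simp [totalPotential]
  | cons k w ih =>
    cases st with
    | nil => simp [totalPotential]
    | cons u st => exact add_nonneg (gapPotential_nonneg hx _) (ih _)

theorem gapPotential_append (x : ℝ) {C : List (List ℕ)} {c : List ℕ} {st : List (List ℕ)}
    (hC : ∀ v ∈ C, v.length = c.length) :
    gapPotential x (C ++ c :: st) = C.length + gapPotential x (c :: st) := by
  induction C with
  | nil => simp
  | cons v C ih =>
    have h1 : topGap x v (C ++ c :: st) = 1 := by
      cases C with
      | nil => simp [topGap, hC v (by simp)]
      | cons v' C => simp [topGap, hC v (by simp), hC v' (by simp)]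
    rw [List.cons_append, gapPotential, h1, ih fun v hv => hC v (by simp [hv])]
    push_cast [List.length_cons]
    ring

theorem gapPotential_children_le {x : ℝ} (hx : 1 ≤ x) (u : List ℕ) (k : ℕ)
    (st : List (List ℕ)) :
    gapPotential x (children u (k + 1) ++ st) ≤ k + x * topGap x u st + gapPotential x st := by
  have h1 : children u (k + 1) = children u k ++ [u ++ [k + 1]] := by
    simp [children, List.range_succ]
  rw [h1, List.append_assoc, List.singleton_append, gapPotential_append, length_children,
    gapPotential]
  · have h2 : topGap x (u ++ [k + 1]) st ≤ x * topGap x u st := by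
      cases st with
      | nil => simp [topGap]
      | cons v st =>
        simp only [topGap, ← pow_succ']
        refine pow_le_pow_right₀ hx ?_
        simp only [List.length_append, List.length_singleton]
        omega
    linarith
  · intro v hv
    obtain ⟨i, -, -, rfl⟩ := mem_children.1 hv
    simp

theorem sum_mul_gapPotential_le {μ : ℕ → ℝ} {K : ℕ} {x : ℝ} (hμ0 : ∀ k, 0 ≤ μ k)
    (hμ : ∑ k ∈ Finset.range (K + 1), μ k = 1)
    (hmean : ∑ k ∈ Finset.range (K + 1), (k : ℝ) * μ k = 1) (hx : 1 ≤ x)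
    (hx' : x * (1 - μ 0) = 1) (u : List ℕ) (st : List (List ℕ)) :
    ∑ k ∈ Finset.range (K + 1), μ k * gapPotential x (children u k ++ st) ≤
      gapPotential x (u :: st) + 1 := by
  rw [Finset.sum_range_succ'] at hμ hmean ⊢
  have h0 : children u 0 = [] := rfl
  rw [h0, List.nil_append]
  have h1 : ∑ k ∈ Finset.range K, μ (k + 1) * gapPotential x (children u (k + 1) ++ st) ≤
      ∑ k ∈ Finset.range K, (((k + 1 : ℕ) : ℝ) * μ (k + 1) +
        (x * topGap x u st + gapPotential x st) * μ (k + 1)) := by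
    refine Finset.sum_le_sum fun k _ => ?_
    have := mul_le_mul_of_nonneg_left (gapPotential_children_le hx u k st) (hμ0 (k + 1))
    have h2 := hμ0 (k + 1)
    push_cast
    nlinarith
  rw [Finset.sum_add_distrib, ← Finset.mul_sum] at h1
  have h2 : ∑ k ∈ Finset.range K, μ (k + 1) = 1 - μ 0 := by linarith
  have h3 : ∑ k ∈ Finset.range K, ((k + 1 : ℕ) : ℝ) * μ (k + 1) = 1 := by simpa using hmean
  rw [h2, h3] at h1
  rw [gapPotential]
  linear_combination h1 + topGap x u st * hx'

theorem sum_words_totalPotential_le {μ : ℕ → ℝ} {K : ℕ} {x : ℝ} (hμ0 : ∀ k, 0 ≤ μ k)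
    (hμ : ∑ k ∈ Finset.range (K + 1), μ k = 1)
    (hmean : ∑ k ∈ Finset.range (K + 1), (k : ℝ) * μ k = 1) (hx : 1 ≤ x)
    (hx' : x * (1 - μ 0) = 1) (N : ℕ) (S : List (List ℕ)) :
    ∑ w ∈ words K N, (w.map μ).prod * totalPotential x w S ≤
      N * gapPotential x S + (N : ℝ) ^ 2 := by
  induction N generalizing S with
  | zero => simp [words, totalPotential]
  | succ N ih =>
    cases S with
    | nil =>
      simp only [totalPotential, mul_zero, Finset.sum_const_zero]
      have := gapPotential_nonneg (zero_le_one.trans hx) []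
      positivity
    | cons u st =>
      have h1 : ∑ w ∈ words K (N + 1), (w.map μ).prod * totalPotential x w (u :: st) =
          gapPotential x (u :: st) + ∑ k ∈ Finset.range (K + 1), μ k *
            ∑ w ∈ words K N, (w.map μ).prod * totalPotential x w (children u k ++ st) := by
        rw [sum_words_succ]
        simp only [List.map_cons, List.prod_cons, totalPotential, mul_add,
          Finset.sum_add_distrib, mul_assoc, ← Finset.mul_sum, ← Finset.sum_mul]
        rw [sum_words_prod hμ, hμ, one_mul, one_mul]
      have h2 : ∑ k ∈ Finset.range (K + 1), μ k *
            ∑ w ∈ words K N, (w.map μ).prod * totalPotential x w (children u k ++ st) ≤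
          ∑ k ∈ Finset.range (K + 1), (N * (μ k * gapPotential x (children u k ++ st)) +
            (N : ℝ) ^ 2 * μ k) := by
        refine Finset.sum_le_sum fun k _ => ?_
        have := mul_le_mul_of_nonneg_left (ih (children u k ++ st)) (hμ0 k)
        linarith
      rw [Finset.sum_add_distrib, ← Finset.mul_sum, ← Finset.mul_sum, hμ] at h2
      have h3 := mul_le_mul_of_nonneg_left
        (sum_mul_gapPotential_le hμ0 hμ hmean hx hx' u st) (Nat.cast_nonneg (α := ℝ) N)
      have h4 : (0 : ℝ) ≤ N := Nat.cast_nonneg N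
      rw [h1]
      push_cast
      nlinarith

theorem dfs_length_step {x : ℝ} (hx : 0 ≤ x) (w : List ℕ) (S : List (List ℕ))
    (hS : S.Pairwise fun a b => b.length ≤ a.length) (l : ℕ) (hl : l + 1 < (dfs w S).length) :
    ((dfs w S).getD (l + 1) []).length ≤ ((dfs w S).getD l []).length + 1 ∧
      (((dfs w S).getD (l + 1) []).length < ((dfs w S).getD l []).length →
        x ^ (((dfs w S).getD l []).length - ((dfs w S).getD (l + 1) []).length) ≤
          totalPotential x w S) := by
  induction w generalizing S l with
  | nil => simp [dfs] at hl
  | cons k w ih =>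
    cases S with
    | nil => simp [dfs] at hl
    | cons u st =>
      have hSc := List.pairwise_cons.1 hS
      simp only [dfs, List.length_cons, List.getD_cons_succ, totalPotential] at hl ⊢
      cases l with
      | succ l =>
        have := ih (children u k ++ st) ?_ l (by omega)
        · refine ⟨by simpa using this.1, fun h => ?_⟩
          rw [List.getD_cons_succ] at h ⊢
          exact (this.2 h).trans (le_add_of_nonneg_left (gapPotential_nonneg hx _))
        · rw [List.pairwise_append]
          refine ⟨?_, hSc.2, ?_⟩
          · rw [children, List.pairwise_map]
            exact List.pairwise_lt_range.imp fun _ => by simp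
          · intro a ha b hb
            obtain ⟨i, -, -, rfl⟩ := mem_children.1 ha
            have := hSc.1 b hb
            simp only [List.length_append]
            omega
      | zero =>
        rw [List.getD_cons_zero]
        cases w with
        | nil => simp [dfs] at hl
        | cons k' w =>
          cases k with
          | succ k =>
            have h1 : children u (k + 1) ++ st =
                (u ++ [1]) :: ((List.range k).map (fun i => u ++ [i + 1 + 1]) ++ st) := by
              simp [children, List.range_succ_eq_map, Function.comp_def]
            rw [h1, dfs, List.getD_cons_zero]
            simp
          | zero =>
            have h1 : children u 0 ++ st = st := rfl
            rw [h1] at hl ⊢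
            cases st with
            | nil => simp [dfs] at hl
            | cons v st =>
              rw [dfs, List.getD_cons_zero]
              have hv := hSc.1 v (by simp)
              refine ⟨by omega, fun _ => ?_⟩
              rw [gapPotential, topGap, add_assoc]
              exact le_add_of_nonneg_right
                (add_nonneg (gapPotential_nonneg hx _) (totalPotential_nonneg hx _ _))

/-- Each letter `k ≤ K` occurs `c k` times in the word. -/
def HasCount (K : ℕ) (c : ℕ → ℕ) (w : List ℕ) : Prop :=
  ∀ k ∈ Finset.range (K + 1), w.count k = c k

/-- Words of length `N` over `{0, ..., K}` in which each letter `k` occurs `c k` times. -/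
def wordsWithCount (K N : ℕ) (c : ℕ → ℕ) : Finset (List ℕ) :=
  (words K N).filter (HasCount K c)

theorem card_wordsWithCount_mul (K N : ℕ) (c : ℕ → ℕ)
    (hc : ∑ k ∈ Finset.range (K + 1), c k = N) :
    (wordsWithCount K N c).card * ∏ k ∈ Finset.range (K + 1), (c k).factorial =
      N.factorial := by
  induction N generalizing c with
  | zero =>
    have h0 : ∀ k ∈ Finset.range (K + 1), c k = 0 := Finset.sum_eq_zero_iff.1 hc
    have h1 : wordsWithCount K 0 c = {[]} := by
      refine Finset.filter_true_of_mem fun w hw k hk => ?_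
      rw [h0 k hk, Finset.mem_singleton.1 hw, List.count_nil]
    rw [h1, Finset.prod_eq_one fun k hk => by rw [h0 k hk, Nat.factorial_zero]]
    simp
  | succ N ih =>
    have key : ∀ k ∈ Finset.range (K + 1),
        (∑ w ∈ words K N, if HasCount K c (k :: w) then 1 else 0) *
          ∏ j ∈ Finset.range (K + 1), (c j).factorial = c k * N.factorial := by
      intro k hk
      rw [← Finset.card_filter]
      rcases Nat.eq_zero_or_pos (c k) with h0 | hpos
      · rw [Finset.filter_false_of_mem, h0]
        · simp
        · intro w _ h
          have := h k hk
          rw [List.count_cons_self, h0] at this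
          omega
      · have h1 : (words K N).filter (fun w => HasCount K c (k :: w)) =
              wordsWithCount K N (Function.update c k (c k - 1)) := by
          refine Finset.filter_congr fun w _ => forall₂_congr fun j _ => ?_
          rcases eq_or_ne j k with rfl | hjk
          · rw [List.count_cons_self, Function.update_self]
            omega
          · rw [List.count_cons_of_ne hjk.symm, Function.update_of_ne hjk]
        have h2 : ∏ j ∈ Finset.range (K + 1), (c j).factorial =
            c k * ∏ j ∈ Finset.range (K + 1),
              (Function.update c k (c k - 1) j).factorial := by
          rw [← Finset.mul_prod_erase _ _ hk, ← Finset.mul_prod_erase _ (fun j =>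
            (Function.update c k (c k - 1) j).factorial) hk, Function.update_self, ← mul_assoc,
            Nat.mul_factorial_pred hpos.ne']
          congr 1
          refine Finset.prod_congr rfl fun j hj => ?_
          rw [Function.update_of_ne (Finset.ne_of_mem_erase hj)]
        have h3 : ∑ j ∈ Finset.range (K + 1), Function.update c k (c k - 1) j = N := by
          have hc' : c k + ∑ j ∈ (Finset.range (K + 1)).erase k, c j =
              ∑ j ∈ Finset.range (K + 1), c j := Finset.add_sum_erase _ _ hk
          have herase : ∑ j ∈ (Finset.range (K + 1)).erase k, Function.update c k (c k - 1) j =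
              ∑ j ∈ (Finset.range (K + 1)).erase k, c j :=
            Finset.sum_congr rfl fun j hj => Function.update_of_ne (Finset.ne_of_mem_erase hj) _ _
          rw [← Finset.add_sum_erase _ _ hk, Function.update_self, herase]
          omega
        rw [h1, h2, mul_left_comm, ih _ h3]
    rw [wordsWithCount, Finset.card_filter, sum_words_succ, Finset.sum_mul,
      Finset.sum_congr rfl key, ← Finset.sum_mul, hc, Nat.factorial_succ]

theorem prod_map_eq_prod_pow_count (μ : ℕ → ℝ) {K N : ℕ} {w : List ℕ} (hw : w ∈ words K N) :
    (w.map μ).prod = ∏ k ∈ Finset.range (K + 1), μ k ^ w.count k := by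
  rw [Finset.prod_list_map_count]
  refine Finset.prod_subset (fun k hk => ?_) fun k _ hk => ?_
  · rw [Finset.mem_range, Nat.lt_succ_iff]
    exact (mem_words.1 hw).2 k (List.mem_toFinset.1 hk)
  · rw [List.count_eq_zero_of_not_mem (by simpa using hk), pow_zero]

theorem sum_eq_sum_mul_count {K N : ℕ} {w : List ℕ} (hw : w ∈ words K N) :
    w.sum = ∑ k ∈ Finset.range (K + 1), k * w.count k := by
  have h := Finset.sum_list_map_count w id
  rw [List.map_id] at h
  rw [h]
  refine (Finset.sum_congr rfl fun k _ => by rw [smul_eq_mul, mul_comm, id]).trans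
    (Finset.sum_subset (fun k hk => ?_) fun k _ hk => ?_)
  · rw [Finset.mem_range, Nat.lt_succ_iff]
    exact (mem_words.1 hw).2 k (List.mem_toFinset.1 hk)
  · rw [List.count_eq_zero_of_not_mem (by simpa using hk), mul_zero]

/-- A crude form of Stirling's upper bound. -/
theorem factorial_mul_exp_le (n : ℕ) :
    (n.factorial : ℝ) * Real.exp n ≤ Real.exp 1 * (n + 1) * (n : ℝ) ^ n := by
  have key : ∀ n : ℕ, ((n + 1).factorial : ℝ) * Real.exp ((n : ℝ) + 1) ≤
      Real.exp 1 * ((n : ℝ) + 1) ^ (n + 2) := by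
    intro n
    induction n with
    | zero => simp
    | succ n ih =>
      have hpos : (0 : ℝ) < (n : ℝ) + 1 := by positivity
      have hpos2 : (0 : ℝ) < (n : ℝ) + 2 := by positivity
      have h1 : Real.exp 1 * ((n : ℝ) + 1) ^ (n + 2) ≤ ((n : ℝ) + 2) ^ (n + 2) := by
        have h2 := Real.one_sub_inv_le_log_of_pos (div_pos hpos2 hpos)
        have h3 : 1 ≤ ((n : ℝ) + 2) * Real.log (((n : ℝ) + 2) / ((n : ℝ) + 1)) := by
          rw [inv_div] at h2
          have := mul_le_mul_of_nonneg_left h2 hpos2.le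
          have h5 : ((n : ℝ) + 2) * (1 - ((n : ℝ) + 1) / ((n : ℝ) + 2)) = 1 := by
            field_simp; ring
          linarith
        have h4 : Real.exp 1 ≤ (((n : ℝ) + 2) / ((n : ℝ) + 1)) ^ (n + 2) := by
          rw [← Real.exp_log (div_pos hpos2 hpos), ← Real.exp_nat_mul]
          refine Real.exp_le_exp.2 (h3.trans (le_of_eq ?_))
          push_cast
          rfl
        rw [div_pow, le_div_iff₀ (by positivity)] at h4
        exact h4
      rw [Nat.factorial_succ]
      push_cast
      rw [show (n : ℝ) + 1 + 1 = n + 2 by ring, show Real.exp ((n : ℝ) + 2) =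
        Real.exp ((n : ℝ) + 1) * Real.exp 1 by rw [← Real.exp_add]; ring_nf]
      calc ((n : ℝ) + 2) * ((n + 1).factorial : ℝ) * (Real.exp ((n : ℝ) + 1) * Real.exp 1)
          = ((n : ℝ) + 2) * Real.exp 1 *
              (((n + 1).factorial : ℝ) * Real.exp ((n : ℝ) + 1)) := by ring
        _ ≤ ((n : ℝ) + 2) * Real.exp 1 * (Real.exp 1 * ((n : ℝ) + 1) ^ (n + 2)) := by
            gcongr
        _ ≤ ((n : ℝ) + 2) * Real.exp 1 * ((n : ℝ) + 2) ^ (n + 2) := by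
            gcongr
        _ = Real.exp 1 * ((n : ℝ) + 2) ^ (n + 1 + 2) := by ring
  cases n with
  | zero => simp
  | succ n =>
    have h := key n
    push_cast
    refine h.trans ?_
    rw [pow_succ' ((n : ℝ) + 1) (n + 1), ← mul_assoc]
    gcongr
    linarith

theorem pow_self_le_of_le_add {N c : ℕ} {m C : ℝ} (hcN : c ≤ N) (hm : 0 ≤ m) (hC : 0 ≤ C)
    (hc : (c : ℝ) ≤ N * m + C) (hm0 : m = 0 → c = 0) :
    (c : ℝ) ^ c ≤ (N * m) ^ c * Real.exp (C / m) := by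
  rcases hm.eq_or_lt with rfl | hm
  · simp [hm0 rfl]
  rcases Nat.eq_zero_or_pos N with rfl | hN
  · obtain rfl : c = 0 := by omega
    simp only [pow_zero, one_mul]
    exact Real.one_le_exp (by positivity)
  have hN' : (0 : ℝ) < N := by exact_mod_cast hN
  have h1 : (c : ℝ) ≤ N * m * Real.exp (C / (N * m)) := by
    have := Real.add_one_le_exp (C / (N * m))
    calc (c : ℝ) ≤ N * m * (C / (N * m) + 1) := by
          rw [mul_add, mul_div_cancel₀ _ (by positivity)]; linarith
      _ ≤ _ := by gcongr
  calc (c : ℝ) ^ c ≤ (N * m * Real.exp (C / (N * m))) ^ c := by gcongr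
    _ = (N * m) ^ c * Real.exp (c * (C / (N * m))) := by rw [mul_pow, Real.exp_nat_mul]
    _ ≤ (N * m) ^ c * Real.exp (C / m) := by
      have : (c : ℝ) * (C / (N * m)) ≤ C / m := by
        have h2 : (c : ℝ) ≤ N := by exact_mod_cast hcN
        calc (c : ℝ) * (C / (N * m)) ≤ N * (C / (N * m)) := by gcongr
          _ = C / m := by field_simp
      gcongr

/-- A type class close to the mean type has polynomially small mass at worst. -/
theorem one_le_sum_wordsWithCount {μ : ℕ → ℝ} {K N : ℕ} {C : ℝ} {c : ℕ → ℕ}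
    (hμ0 : ∀ k, 0 ≤ μ k) (hN : 1 ≤ N) (hC : 0 ≤ C)
    (hc : ∑ k ∈ Finset.range (K + 1), c k = N)
    (hle : ∀ k ∈ Finset.range (K + 1), (c k : ℝ) ≤ N * μ k + C)
    (hzero : ∀ k ∈ Finset.range (K + 1), μ k = 0 → c k = 0) :
    1 ≤ (∏ k ∈ Finset.range (K + 1), 2 * Real.exp 1 * Real.exp (C / μ k)) * (N : ℝ) ^ (K + 1) *
      ∑ w ∈ wordsWithCount K N c, (w.map μ).prod := by
  set B : ℕ → ℝ := fun k => 2 * Real.exp 1 * Real.exp (C / μ k) with hB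
  have hN1 : (1 : ℝ) ≤ N := by exact_mod_cast hN
  have hterm : ∀ k ∈ Finset.range (K + 1), ((c k).factorial : ℝ) ≤
      μ k ^ c k * ((N : ℝ) ^ c k * Real.exp (-1) ^ c k) * (B k * N) := by
    intro k hk
    have hcN : c k ≤ N := hc ▸ Finset.single_le_sum (fun _ _ => Nat.zero_le _) hk
    have hcN' : (c k : ℝ) ≤ N := by exact_mod_cast hcN
    have h1 := factorial_mul_exp_le (c k)
    have h2 := pow_self_le_of_le_add hcN (hμ0 k) hC (hle k hk) (hzero k hk)
    have h3 : Real.exp (-1) ^ c k = (Real.exp (c k))⁻¹ := by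
      rw [← Real.exp_nat_mul, ← Real.exp_neg]
      ring_nf
    have h4 : ((c k).factorial : ℝ) * Real.exp (c k) ≤
        Real.exp 1 * (2 * N) * ((N * μ k) ^ c k * Real.exp (C / μ k)) := by
      refine h1.trans ?_
      have := mul_nonneg (zero_le_one.trans hN1) (hμ0 k)
      gcongr
      linarith
    rw [← le_div_iff₀ (Real.exp_pos _)] at h4
    refine h4.trans (le_of_eq ?_)
    rw [h3, hB, mul_pow]
    field_simp
  have hprod : ∏ k ∈ Finset.range (K + 1), ((c k).factorial : ℝ) ≤
      (∏ k ∈ Finset.range (K + 1), μ k ^ c k) * N.factorial *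
        ((∏ k ∈ Finset.range (K + 1), B k) * (N : ℝ) ^ (K + 1)) := by
    refine (Finset.prod_le_prod (fun _ _ => Nat.cast_nonneg _) hterm).trans ?_
    rw [Finset.prod_mul_distrib, Finset.prod_mul_distrib, Finset.prod_mul_distrib,
      Finset.prod_mul_distrib, Finset.prod_pow_eq_pow_sum, Finset.prod_pow_eq_pow_sum, hc,
      Finset.prod_const, Finset.card_range]
    have h1 : (N : ℝ) ^ N * Real.exp (-1) ^ N ≤ N.factorial := by
      have := Real.pow_div_factorial_le_exp (N : ℝ) (Nat.cast_nonneg N) N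
      rw [div_le_iff₀ (by positivity)] at this
      rw [← Real.exp_nat_mul, mul_neg_one, Real.exp_neg, ← div_eq_mul_inv,
        div_le_iff₀ (Real.exp_pos _)]
      linarith
    have h2 : 0 ≤ ∏ k ∈ Finset.range (K + 1), μ k ^ c k :=
      Finset.prod_nonneg fun k _ => pow_nonneg (hμ0 k) _
    have h3 : 0 ≤ ∏ k ∈ Finset.range (K + 1), B k :=
      Finset.prod_nonneg fun k _ => by positivity
    gcongr
  have hmass : ∑ w ∈ wordsWithCount K N c, (w.map μ).prod =
      (wordsWithCount K N c).card * ∏ k ∈ Finset.range (K + 1), μ k ^ c k := by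
    rw [← nsmul_eq_mul, ← Finset.sum_const]
    refine Finset.sum_congr rfl fun w hw => ?_
    rw [wordsWithCount, Finset.mem_filter] at hw
    rw [prod_map_eq_prod_pow_count μ hw.1]
    exact Finset.prod_congr rfl fun k hk => by rw [hw.2 k hk]
  have hcard : ((wordsWithCount K N c).card : ℝ) *
      ∏ k ∈ Finset.range (K + 1), ((c k).factorial : ℝ) = N.factorial := by
    exact_mod_cast card_wordsWithCount_mul K N c hc
  have hfac : (0 : ℝ) < N.factorial := by positivity
  have := mul_le_mul_of_nonneg_left hprod (Nat.cast_nonneg (α := ℝ) (wordsWithCount K N c).card)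
  rw [hcard] at this
  rw [hmass]
  refine le_of_mul_le_mul_right ?_ hfac
  linarith

theorem prod_map_nonneg {μ : ℕ → ℝ} (hμ0 : ∀ k, 0 ≤ μ k) (w : List ℕ) : 0 ≤ (w.map μ).prod :=
  List.prod_nonneg fun a ha => by
    obtain ⟨k, -, rfl⟩ := List.mem_map.1 ha
    exact hμ0 k

theorem sum_prod_le_mul_sum_run {μ : ℕ → ℝ} (hμ0 : ∀ k, 0 ≤ μ k) {K N : ℕ}
    {A : Finset (List ℕ)} (hA : A ⊆ words K N) (hsum : ∀ w ∈ A, w.sum + 1 = N) :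
    ∑ w ∈ A, (w.map μ).prod ≤
      N * ∑ w ∈ (words K N).filter (fun w => Run 1 w 0), (w.map μ).prod := by
  have hlen : ∀ w ∈ A, w.length = N := fun w hw => (mem_words.1 (hA hw)).1
  have hex : ∀ w : List ℕ, ∃ r, w ∈ A → r < N ∧ Run 1 (w.rotate r) 0 := by
    intro w
    by_cases hw : w ∈ A
    · obtain ⟨r, hr, h⟩ := exists_rotate_run ((hsum w hw).trans (hlen w hw).symm)
      exact ⟨r, fun _ => ⟨hlen w hw ▸ hr, h⟩⟩
    · exact ⟨0, fun h => absurd h hw⟩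
  choose r hr using hex
  have hinj : Set.InjOn (fun w : List ℕ => (r w, w.rotate (r w))) A := by
    intro w _ w' _ h
    simp only [Prod.mk.injEq] at h
    rw [h.1] at h
    exact List.rotate_injective _ h.2
  calc ∑ w ∈ A, (w.map μ).prod
      = ∑ p ∈ A.image (fun w : List ℕ => (r w, w.rotate (r w))), (p.2.map μ).prod := by
        rw [Finset.sum_image hinj]
        exact Finset.sum_congr rfl fun w _ => (((w.rotate_perm (r w)).map μ).prod_eq).symm
    _ ≤ ∑ p ∈ Finset.range N ×ˢ (words K N).filter (fun w => Run 1 w 0),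
          (p.2.map μ).prod := by
        refine Finset.sum_le_sum_of_subset_of_nonneg ?_ fun p _ _ => prod_map_nonneg hμ0 _
        intro p hp
        obtain ⟨w, hw, rfl⟩ := Finset.mem_image.1 hp
        have hw' := mem_words.1 (hA hw)
        simp only [Finset.mem_product, Finset.mem_range, Finset.mem_filter, mem_words,
          List.length_rotate, List.mem_rotate]
        exact ⟨(hr w hw).1, hw', (hr w hw).2⟩
    _ = _ := by
        rw [Finset.sum_product]
        simp

theorem exists_near_modEq {k₀ : ℕ} (hk₀ : 1 ≤ k₀) (a : ℕ) {t : ℝ} (ht : 0 ≤ t) :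
    ∃ d : ℕ, (d : ℝ) ≤ t + k₀ ∧ t - 1 ≤ d ∧ (k₀ : ℤ) ∣ (a : ℤ) - d ∧ (t = 0 → a = 0 → d = 0) := by
  have hpos : (0 : ℤ) < k₀ := by exact_mod_cast hk₀
  have h1 := Int.emod_nonneg ((a : ℤ) - ⌊t⌋₊) hpos.ne'
  have h2 := Int.emod_lt_of_pos ((a : ℤ) - ⌊t⌋₊) hpos
  have h3 := Int.mul_ediv_add_emod ((a : ℤ) - ⌊t⌋₊) k₀
  obtain ⟨r, hr⟩ := Int.eq_ofNat_of_zero_le h1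
  rw [hr] at h2 h3
  have h2' : (r : ℝ) ≤ k₀ := by exact_mod_cast h2.le
  refine ⟨⌊t⌋₊ + r, ?_, ?_, ⟨((a : ℤ) - ⌊t⌋₊) / k₀, by push_cast; linarith⟩, ?_⟩
  · push_cast
    have := Nat.floor_le ht
    linarith
  · push_cast
    have := Nat.lt_floor_add_one t
    have : (0 : ℝ) ≤ r := Nat.cast_nonneg r
    linarith
  · rintro rfl rfl
    simp at hr
    simpa using hr.symm

theorem sum_range_split {M : Type*} [AddCommMonoid M] {K k₀ : ℕ} (h1 : 1 ≤ k₀) (h2 : k₀ ≤ K)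
    (f : ℕ → M) : ∑ k ∈ Finset.range (K + 1), f k =
      f 0 + (f k₀ + ∑ k ∈ ((Finset.range (K + 1)).erase 0).erase k₀, f k) := by
  rw [Finset.add_sum_erase _ _ (by simp; omega), Finset.add_sum_erase _ _ (by simp)]

/-- Whenever some word over the support of `μ` codes a tree with `N` vertices, there is such a type
at bounded distance of `N * μ`. -/
theorem exists_count_near_mean {μ : ℕ → ℝ} {K k₀ : ℕ} (hμ0 : ∀ k, 0 ≤ μ k)
    (hμ : ∑ k ∈ Finset.range (K + 1), μ k = 1)
    (hmean : ∑ k ∈ Finset.range (K + 1), (k : ℝ) * μ k = 1)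
    (hpos0 : 0 < μ 0) (h1 : 1 ≤ k₀) (h2 : k₀ ≤ K) (hpos : 0 < μ k₀) :
    ∃ C : ℝ, 0 ≤ C ∧ ∀ᶠ N : ℕ in atTop, ∀ w ∈ words K N, w.sum + 1 = N →
      (∀ k ∈ w, μ k ≠ 0) → ∃ c : ℕ → ℕ,
        ∑ k ∈ Finset.range (K + 1), c k = N ∧
        ∑ k ∈ Finset.range (K + 1), k * c k + 1 = N ∧
        (∀ k ∈ Finset.range (K + 1), (c k : ℝ) ≤ N * μ k + C) ∧
        ∀ k ∈ Finset.range (K + 1), μ k = 0 → c k = 0 := by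
  set E := ((Finset.range (K + 1)).erase 0).erase k₀ with hE
  set s : ℝ := ∑ k ∈ E, (k : ℝ) with hs
  set e : ℝ := ∑ k ∈ E, (1 : ℝ) with he
  have hs0 : 0 ≤ s := Finset.sum_nonneg fun _ _ => Nat.cast_nonneg _
  have he0 : 0 ≤ e := Finset.sum_nonneg fun _ _ => zero_le_one
  have hk₀1 : (1 : ℝ) ≤ k₀ := by exact_mod_cast h1
  refine ⟨k₀ + 1 + s + e, by positivity, ?_⟩
  have hlim : ∀ a b : ℝ, 0 < a → ∀ᶠ N : ℕ in atTop, b ≤ N * a := fun a b ha =>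
    ((tendsto_natCast_atTop_atTop.atTop_mul_const ha).eventually_ge_atTop b)
  filter_upwards [hlim _ (1 + k₀ * s) (mul_pos (zero_lt_one.trans_le hk₀1) hpos),
    hlim _ (e * k₀ + s) hpos0] with N hN1 hN2 w hw hsum hsupp
  have hN0 : (0 : ℝ) ≤ N := Nat.cast_nonneg N
  have hex := fun k => exists_near_modEq h1 (w.count k) (mul_nonneg hN0 (hμ0 k))
  choose d hd1 hd2 hd3 hd4 using hex
  rw [sum_range_split h1 h2] at hμ hmean
  rw [Nat.cast_zero, zero_mul, zero_add] at hmean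
  have hcount : w.sum = k₀ * w.count k₀ + ∑ k ∈ E, k * w.count k := by
    rw [sum_eq_sum_mul_count hw, sum_range_split h1 h2, zero_mul, zero_add]
  have hdvd : (k₀ : ℤ) ∣ (N : ℤ) - 1 - ∑ k ∈ E, (k : ℤ) * d k := by
    have : (N : ℤ) - 1 - ∑ k ∈ E, (k : ℤ) * d k =
        k₀ * w.count k₀ + ∑ k ∈ E, (k : ℤ) * ((w.count k : ℤ) - d k) := by
      simp only [mul_sub, Finset.sum_sub_distrib]
      have h : (N : ℤ) = k₀ * w.count k₀ + ∑ k ∈ E, (k : ℤ) * w.count k + 1 := by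
        rw [← hsum, hcount]
        push_cast
        rfl
      rw [h]
      ring
    rw [this]
    exact dvd_add (dvd_mul_right _ _) (Finset.dvd_sum fun k _ => (hd3 k).mul_left _)
  obtain ⟨q, hq⟩ := hdvd
  have hqR : (N : ℝ) - 1 - ∑ k ∈ E, (k : ℝ) * d k = k₀ * q := by exact_mod_cast hq
  have hup : ∑ k ∈ E, (k : ℝ) * d k ≤ N * ∑ k ∈ E, (k : ℝ) * μ k + k₀ * s := by
    rw [hs, Finset.mul_sum, Finset.mul_sum, ← Finset.sum_add_distrib]
    refine Finset.sum_le_sum fun k _ => ?_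
    have := mul_le_mul_of_nonneg_left (hd1 k) (Nat.cast_nonneg (α := ℝ) k)
    linarith
  have hlow : N * ∑ k ∈ E, (k : ℝ) * μ k - s ≤ ∑ k ∈ E, (k : ℝ) * d k := by
    rw [hs, Finset.mul_sum, ← Finset.sum_sub_distrib]
    refine Finset.sum_le_sum fun k _ => ?_
    have := mul_le_mul_of_nonneg_left (hd2 k) (Nat.cast_nonneg (α := ℝ) k)
    linarith
  have hup' : ∑ k ∈ E, (d k : ℝ) ≤ N * ∑ k ∈ E, μ k + e * k₀ := by
    rw [he, Finset.mul_sum, Finset.sum_mul, ← Finset.sum_add_distrib]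
    refine Finset.sum_le_sum fun k _ => ?_
    have := hd1 k
    linarith
  have hlow' : N * ∑ k ∈ E, μ k - e ≤ ∑ k ∈ E, (d k : ℝ) := by
    rw [he, Finset.mul_sum, ← Finset.sum_sub_distrib]
    exact Finset.sum_le_sum fun k _ => hd2 k
  have hEm : ∑ k ∈ E, (k : ℝ) * μ k = 1 - k₀ * μ k₀ := by linarith
  have hEμ : ∑ k ∈ E, μ k = 1 - μ 0 - μ k₀ := by linarith
  rw [hEm] at hup hlow
  rw [hEμ] at hup' hlow'
  have hq0 : 0 ≤ q := by
    have : (0 : ℝ) ≤ k₀ * q := by rw [← hqR]; nlinarith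
    have : (0 : ℝ) ≤ q := nonneg_of_mul_nonneg_right this (by linarith)
    exact_mod_cast this
  have hqup : (q : ℝ) ≤ N * μ k₀ + s := by
    have : (k₀ : ℝ) * q ≤ k₀ * (N * μ k₀ + s) := by
      rw [← hqR]
      nlinarith
    exact le_of_mul_le_mul_left this (by linarith)
  have hqlow : N * μ k₀ - 1 - s ≤ (q : ℝ) := by
    have : (k₀ : ℝ) * (N * μ k₀ - 1 - s) ≤ k₀ * q := by
      rw [← hqR]
      nlinarith
    exact le_of_mul_le_mul_left this (by linarith)
  obtain ⟨q, rfl⟩ := Int.eq_ofNat_of_zero_le hq0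
  rw [Int.cast_natCast] at hqR hqup hqlow
  have hle : q + ∑ k ∈ E, d k ≤ N := by
    have : (q : ℝ) + ∑ k ∈ E, (d k : ℝ) ≤ N := by nlinarith
    exact_mod_cast this
  obtain ⟨z, hz⟩ := Nat.exists_eq_add_of_le hle
  have hzR : (N : ℝ) = q + ∑ k ∈ E, (d k : ℝ) + z := by exact_mod_cast hz
  set c : ℕ → ℕ := fun k => if k = 0 then z else if k = k₀ then q else d k with hc
  have hc0 : c 0 = z := by simp [hc]
  have hck₀ : c k₀ = q := by simp [hc]; omega
  have hcE : ∀ k ∈ E, c k = d k := by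
    intro k hk
    simp only [hE, Finset.mem_erase] at hk
    simp [hc, hk.1, hk.2.1]
  refine ⟨c, ?_, ?_, ?_, ?_⟩
  · have hsum : ∑ k ∈ E, c k = ∑ k ∈ E, d k := Finset.sum_congr rfl hcE
    rw [sum_range_split h1 h2, hc0, hck₀, hsum]
    omega
  · rw [sum_range_split h1 h2, hck₀, zero_mul, zero_add,
      Finset.sum_congr rfl fun k hk => by rw [hcE k hk]]
    have : ((k₀ * q + ∑ k ∈ E, k * d k + 1 : ℕ) : ℤ) = N := by
      push_cast
      linarith
    exact_mod_cast this
  · intro k hk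
    rcases eq_or_ne k 0 with rfl | hk0
    · rw [hc0]
      nlinarith
    · rcases eq_or_ne k k₀ with rfl | hkk
      · rw [hck₀]
        linarith
      · rw [hcE k (by simp [hE, hk0, hkk]; simpa [Nat.lt_succ_iff] using hk)]
        have := hd1 k
        linarith
  · intro k hk hk'
    have hk0 : k ≠ 0 := by rintro rfl; exact hpos0.ne' hk'
    have hkk : k ≠ k₀ := by rintro rfl; exact hpos.ne' hk'
    rw [hcE k (by simp [hE, hk0, hkk]; simpa [Nat.lt_succ_iff] using hk)]
    refine hd4 k (by rw [hk', mul_zero]) ?_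
    exact List.count_eq_zero_of_not_mem fun h => hsupp k h hk'

theorem finite_setOf_card (N : ℕ) : {T : PlanarTree | T.val.card = N}.Finite := by
  refine Set.Finite.of_finite_image (f := degreeWord) ?_ degreeWord_injective.injOn
  refine (words N N).finite_toSet.subset ?_
  rintro _ ⟨T, hT, rfl⟩
  rw [Finset.mem_coe, mem_words, length_degreeWord]
  refine ⟨hT, fun k hk => ?_⟩
  obtain ⟨u, -, rfl⟩ := List.mem_map.1 hk
  exact (Finset.card_filter_le _ _).trans_eq hT

theorem gwProb_eq_sum_image (μ : ℕ → ℝ) {S : Set PlanarTree} (hS : S.Finite) :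
    gwProb μ S = ∑ w ∈ hS.toFinset.image degreeWord, (w.map μ).prod := by
  rw [Finset.sum_image degreeWord_injective.injOn, gwProb]
  rw [← Finset.tsum_subtype' hS.toFinset (fun T : PlanarTree => ((degreeWord T).map μ).prod)]
  rw [hS.coe_toFinset]
  exact tsum_congr fun T => gwWeight_eq_prod μ T.val

theorem sum_run_le_treeSizeProb {μ : ℕ → ℝ} (hμ0 : ∀ k, 0 ≤ μ k) (K N : ℕ) :
    ∑ w ∈ (words K N).filter (fun w => Run 1 w 0), (w.map μ).prod ≤ treeSizeProb μ N := by
  rw [treeSizeProb, gwProb_eq_sum_image μ (finite_setOf_card N)]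
  refine Finset.sum_le_sum_of_subset_of_nonneg (fun w hw => ?_) fun w _ _ => prod_map_nonneg hμ0 w
  rw [Finset.mem_filter, mem_words] at hw
  obtain ⟨T, rfl⟩ := exists_degreeWord_eq hw.2
  refine Finset.mem_image_of_mem _ ?_
  simpa [length_degreeWord] using hw.1.1

theorem gwProb_mul_le {μ : ℕ → ℝ} {K N : ℕ} (hμ0 : ∀ k, 0 ≤ μ k) (hK : ∀ k, K < k → μ k = 0)
    {S : Set PlanarTree} {y : ℝ} {F : List ℕ → ℝ} (hF : ∀ w, 0 ≤ F w)
    (hS : ∀ T ∈ S, T.val.card = N ∧ y ≤ F (degreeWord T)) :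
    gwProb μ S * y ≤ ∑ w ∈ words K N, (w.map μ).prod * F w := by
  have hfin : S.Finite := (finite_setOf_card N).subset fun T hT => (hS T hT).1
  rw [gwProb_eq_sum_image μ hfin, Finset.sum_mul]
  set I := hfin.toFinset.image degreeWord with hI
  have hmem : ∀ w ∈ I, w.length = N ∧ y ≤ F w := by
    intro w hw
    obtain ⟨T, hT, rfl⟩ := Finset.mem_image.1 hw
    rw [length_degreeWord]
    exact hS T (by simpa using hT)
  calc ∑ w ∈ I, (w.map μ).prod * y
      ≤ ∑ w ∈ I, (w.map μ).prod * F w := Finset.sum_le_sum fun w hw =>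
        mul_le_mul_of_nonneg_left (hmem w hw).2 (prod_map_nonneg hμ0 w)
    _ = ∑ w ∈ I.filter (· ∈ words K N), (w.map μ).prod * F w := by
        refine (Finset.sum_filter_of_ne fun w hw hne => ?_).symm
        refine mem_words.2 ⟨(hmem w hw).1, fun k hk => ?_⟩
        by_contra! h
        refine hne ?_
        rw [List.prod_eq_zero (List.mem_map.2 ⟨k, hk, hK k h⟩), zero_mul]
    _ ≤ ∑ w ∈ words K N, (w.map μ).prod * F w :=
        Finset.sum_le_sum_of_subset_of_nonneg (fun w hw => (Finset.mem_filter.1 hw).2)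
          fun w _ _ => mul_nonneg (prod_map_nonneg hμ0 w) (hF w)

theorem exists_word_of_treeSizeProb_ne_zero {μ : ℕ → ℝ} {K N : ℕ} (hK : ∀ k, K < k → μ k = 0)
    (h : treeSizeProb μ N ≠ 0) :
    ∃ w ∈ words K N, w.sum + 1 = N ∧ ∀ k ∈ w, μ k ≠ 0 := by
  rw [treeSizeProb, gwProb_eq_sum_image μ (finite_setOf_card N)] at h
  obtain ⟨w, hw, hne⟩ := Finset.exists_ne_zero_of_sum_ne_zero h
  obtain ⟨T, hT, rfl⟩ := Finset.mem_image.1 hw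
  have hsupp : ∀ k ∈ degreeWord T, μ k ≠ 0 := fun k hk h0 =>
    hne (List.prod_eq_zero (List.mem_map.2 ⟨k, hk, h0⟩))
  have hlen : (degreeWord T).length = N := by
    rw [length_degreeWord]
    simpa using hT
  refine ⟨_, mem_words.2 ⟨hlen, fun k hk => ?_⟩, ?_, hsupp⟩
  · by_contra! h
    exact hsupp k hk (hK k h)
  · have := (dfs_degreeWord T).2.sum_eq
    omega

theorem exists_le_treeSizeProb {μ : ℕ → ℝ} {K : ℕ} (hμ0 : ∀ k, 0 ≤ μ k)
    (hK : ∀ k, K < k → μ k = 0) (hμ : ∑ k ∈ Finset.range (K + 1), μ k = 1)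
    (hmean : ∑ k ∈ Finset.range (K + 1), (k : ℝ) * μ k = 1) (hpos0 : 0 < μ 0) :
    ∃ B : ℝ, 0 < B ∧ ∀ᶠ N : ℕ in atTop, treeSizeProb μ N ≠ 0 →
      1 ≤ B * (N : ℝ) ^ (K + 2) * treeSizeProb μ N := by
  obtain ⟨k₀, hk₀, hne⟩ := Finset.exists_ne_zero_of_sum_ne_zero (hmean ▸ one_ne_zero)
  have h1 : 1 ≤ k₀ := by
    rw [Nat.one_le_iff_ne_zero]
    rintro rfl
    simp at hne
  have hpos : 0 < μ k₀ := lt_of_le_of_ne (hμ0 k₀) (right_ne_zero_of_mul hne).symm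
  have h2 : k₀ ≤ K := Nat.lt_succ_iff.1 (Finset.mem_range.1 hk₀)
  obtain ⟨C, hC, hev⟩ := exists_count_near_mean hμ0 hμ hmean hpos0 h1 h2 hpos
  refine ⟨∏ k ∈ Finset.range (K + 1), 2 * Real.exp 1 * Real.exp (C / μ k),
    Finset.prod_pos fun k _ => by positivity, ?_⟩
  filter_upwards [hev, eventually_ge_atTop 1] with N hN hN1 hsize
  obtain ⟨w, hw, hsum, hsupp⟩ := exists_word_of_treeSizeProb_ne_zero hK hsize
  obtain ⟨c, hc, hcsum, hle, hzero⟩ := hN w hw hsum hsupp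
  refine (one_le_sum_wordsWithCount hμ0 hN1 hC hc hle hzero).trans ?_
  have h3 : ∑ w ∈ wordsWithCount K N c, (w.map μ).prod ≤ N * treeSizeProb μ N := by
    refine (sum_prod_le_mul_sum_run hμ0 (Finset.filter_subset _ _) fun w hw => ?_).trans
      (mul_le_mul_of_nonneg_left (sum_run_le_treeSizeProb hμ0 K N) (Nat.cast_nonneg N))
    rw [Finset.mem_filter] at hw
    rw [sum_eq_sum_mul_count hw.1, ← hcsum]
    exact congrArg (· + 1) (Finset.sum_congr rfl fun k hk => by rw [hw.2 k hk])
  rw [pow_succ (N : ℝ) (K + 1), ← mul_assoc, mul_assoc _ (N : ℝ)]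
  refine mul_le_mul_of_nonneg_left h3 ?_
  exact mul_nonneg (Finset.prod_nonneg fun k _ => by positivity) (by positivity)

theorem le_totalPotential_of_gap {x δ : ℝ} (hx : 1 < x) (hδ : 1 < δ) {T : PlanarTree} {n l : ℕ}
    (hl : l < n) (hT : T.val.card = n + 1)
    (h : δ ≤ |((vertexAt T (l + 1)).length : ℝ) - ((vertexAt T l).length : ℝ)|) :
    Real.exp (δ * Real.log x) ≤ totalPotential x (degreeWord T) [[]] := by
  have hdfs := (dfs_degreeWord T).1
  have hlen : l + 1 < (dfs (degreeWord T) [[]]).length := by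
    rw [hdfs]
    simp only [vertexList, Finset.length_sort]
    omega
  have key := dfs_length_step (zero_le_one.trans hx.le) (degreeWord T) [[]] (by simp) l hlen
  rw [hdfs] at key
  change (vertexAt T (l + 1)).length ≤ (vertexAt T l).length + 1 ∧
    ((vertexAt T (l + 1)).length < (vertexAt T l).length →
      x ^ ((vertexAt T l).length - (vertexAt T (l + 1)).length) ≤ _) at key
  generalize (vertexAt T (l + 1)).length = a at h key
  generalize (vertexAt T l).length = b at h key
  have hab : (a : ℝ) ≤ b + 1 := by exact_mod_cast key.1
  have hlt : a < b := by
    by_contra! hba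
    have : (b : ℝ) ≤ a := by exact_mod_cast hba
    rw [abs_of_nonneg (by linarith)] at h
    linarith
  refine le_trans ?_ (key.2 hlt)
  have hlt' : (a : ℝ) < b := by exact_mod_cast hlt
  rw [abs_of_neg (by linarith)] at h
  rw [← Real.exp_log (zero_lt_one.trans hx), ← Real.exp_nat_mul, Real.log_exp,
    Nat.cast_sub hlt.le]
  refine Real.exp_le_exp.2 (mul_le_mul_of_nonneg_right (by linarith) (Real.log_pos hx).le)

theorem mass_zero_pos {μ : ℕ → ℝ} {K : ℕ} (hμ0 : ∀ k, 0 ≤ μ k)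
    (hμ : ∑ k ∈ Finset.range (K + 1), μ k = 1)
    (hmean : ∑ k ∈ Finset.range (K + 1), (k : ℝ) * μ k = 1) (hnd : μ 0 + μ 1 ≠ 1)
    (hK : ∀ k, K < k → μ k = 0) : 0 < μ 0 := by
  refine lt_of_le_of_ne (hμ0 0) fun h0 => hnd ?_
  have h1 : ∑ k ∈ Finset.range (K + 1), ((k : ℝ) - 1) * μ k = 0 := by
    simp only [sub_mul, one_mul, Finset.sum_sub_distrib, hμ, hmean, sub_self]
  have h2 : ∀ k ∈ Finset.range (K + 1), ((k : ℝ) - 1) * μ k = 0 := by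
    refine (Finset.sum_eq_zero_iff_of_nonneg fun k _ => ?_).1 h1
    rcases Nat.eq_zero_or_pos k with rfl | hk
    · simp [← h0]
    · have : (1 : ℝ) ≤ k := by exact_mod_cast hk
      exact mul_nonneg (by linarith) (hμ0 k)
  have h3 : ∀ k, k ≠ 1 → μ k = 0 := by
    intro k hk
    rcases lt_or_ge K k with h | h
    · exact hK k h
    · refine (mul_eq_zero.1 (h2 k (Finset.mem_range.2 (by omega)))).resolve_left ?_
      refine sub_ne_zero.2 ?_
      exact_mod_cast hk
  rw [← h0, zero_add]
  rw [Finset.sum_eq_single 1 (fun k _ hk => h3 k hk)] at hμ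
  · exact hμ
  · intro h
    exact hK 1 (by simpa using h)

/-- Assume (H1).  For any `c > 0` there is a `ρ > 0` such that
`P_n(max_{0 ≤ l < n} ||u(l+1)| - |u(l)|| ≥ ρ log n) = O(n^{-c})`. -/
theorem statement8
    (μ : ℕ → ℝ) (K : ℕ) (hμ : H1 μ K) (c : ℝ) (hc : 0 < c) :
    ∃ ρ > (0 : ℝ), ∃ C > (0 : ℝ), ∀ᶠ n : ℕ in atTop,
      condProb μ n
        {T | ∃ l < n,
          ρ * Real.log n ≤
            |((vertexAt T (l + 1)).length : ℝ) - ((vertexAt T l).length : ℝ)|}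
        ≤ C * (n : ℝ) ^ (-c) := by
  obtain ⟨hμ0, hsum, hnd, hmean, -, hK⟩ := hμ
  have hsum' : ∑ k ∈ Finset.range (K + 1), μ k = 1 :=
    (hasSum_sum_of_ne_finset_zero fun k hk => hK k (by simpa using hk)).unique hsum
  have hmean' : ∑ k ∈ Finset.range (K + 1), (k : ℝ) * μ k = 1 :=
    (hasSum_sum_of_ne_finset_zero fun k hk => by
      rw [hK k (by simpa using hk), mul_zero]).unique hmean
  have hμ0pos : 0 < μ 0 := mass_zero_pos hμ0 hsum' hmean' hnd hK
  have hμ0lt : μ 0 < 1 := by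
    by_contra! h
    have h1 : ∑ k ∈ Finset.range K, μ (k + 1) ≤ 0 := by
      rw [Finset.sum_range_succ'] at hsum'
      linarith
    have h2 : ∀ k ∈ Finset.range K, μ (k + 1) = 0 :=
      (Finset.sum_eq_zero_iff_of_nonneg fun k _ => hμ0 _).1
        (le_antisymm h1 (Finset.sum_nonneg fun k _ => hμ0 _))
    rw [Finset.sum_range_succ', Finset.sum_eq_zero fun k hk => by rw [h2 k hk, mul_zero]] at hmean'
    simp at hmean'
  set x : ℝ := (1 - μ 0)⁻¹ with hx
  have hx1 : 1 < x := (one_lt_inv₀ (by linarith)).2 (by linarith)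
  have hx' : x * (1 - μ 0) = 1 := inv_mul_cancel₀ (by linarith)
  have hlogx : 0 < Real.log x := Real.log_pos hx1
  obtain ⟨B, hB, hsize⟩ := exists_le_treeSizeProb hμ0 hK hsum' hmean' hμ0pos
  set ρ : ℝ := (c + (K + 4)) / Real.log x with hρ
  have hρpos : 0 < ρ := by positivity
  refine ⟨ρ, hρpos, B * 2 ^ (K + 4), by positivity, ?_⟩
  have hlim : ∀ᶠ n : ℕ in atTop, 1 < ρ * Real.log n :=
    ((Real.tendsto_log_atTop.comp tendsto_natCast_atTop_atTop).const_mul_atTop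
      hρpos).eventually_gt_atTop 1
  filter_upwards [hlim, (tendsto_add_atTop_nat 1).eventually hsize, eventually_ge_atTop 1]
    with n hn hlow hn1
  have hnR : (1 : ℝ) ≤ n := by exact_mod_cast hn1
  have hnpos : (0 : ℝ) < n := by linarith
  rw [condProb]
  rcases eq_or_ne (treeSizeProb μ (n + 1)) 0 with h0 | h0
  · rw [h0, div_zero]
    positivity
  have hlow' := hlow h0
  have hp : 0 < treeSizeProb μ (n + 1) := by
    by_contra! h
    have : B * ((n + 1 : ℕ) : ℝ) ^ (K + 2) * treeSizeProb μ (n + 1) ≤ 0 :=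
      mul_nonpos_of_nonneg_of_nonpos (by positivity) h
    linarith
  rw [div_le_iff₀ hp]
  set S := {T : PlanarTree | ∃ l < n, ρ * Real.log n ≤
    |((vertexAt T (l + 1)).length : ℝ) - ((vertexAt T l).length : ℝ)|} ∩
      {T | T.val.card = n + 1} with hS
  have hy : Real.exp (ρ * Real.log n * Real.log x) = (n : ℝ) ^ (c + (K + 4)) := by
    rw [Real.rpow_def_of_pos hnpos, hρ]
    congr 1
    field_simp
  have hup : gwProb μ S * (n : ℝ) ^ (c + (K + 4)) ≤ ((n + 1 : ℕ) : ℝ) ^ 2 := by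
    rw [← hy]
    refine (gwProb_mul_le (N := n + 1) hμ0 hK (F := fun w => totalPotential x w [[]])
      (fun w => totalPotential_nonneg (zero_le_one.trans hx1.le) w _) ?_).trans
      ((sum_words_totalPotential_le hμ0 hsum' hmean' hx1.le hx' (n + 1) [[]]).trans_eq ?_)
    · rintro T ⟨⟨l, hl, h⟩, hT⟩
      exact ⟨hT, le_totalPotential_of_gap hx1 hn hl hT h⟩
    · simp [gapPotential, topGap]
  have hsplit : (n : ℝ) ^ (c + (K + 4)) = (n : ℝ) ^ c * (n : ℝ) ^ (K + 4) := by
    rw [Real.rpow_add hnpos, ← Real.rpow_natCast (n : ℝ) (K + 4)]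
    push_cast
    rfl
  have hcpos : 0 < (n : ℝ) ^ c := Real.rpow_pos_of_pos hnpos c
  rw [Real.rpow_neg hnpos.le]
  have h2n : ((n + 1 : ℕ) : ℝ) ≤ 2 * n := by push_cast; linarith
  have hfinal : gwProb μ S * ((n : ℝ) ^ c * (n : ℝ) ^ (K + 4)) ≤
      B * 2 ^ (K + 4) * (n : ℝ) ^ (K + 4) * treeSizeProb μ (n + 1) := by
    rw [← hsplit]
    calc _ ≤ ((n + 1 : ℕ) : ℝ) ^ 2 := hup
      _ ≤ ((n + 1 : ℕ) : ℝ) ^ 2 *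
          (B * ((n + 1 : ℕ) : ℝ) ^ (K + 2) * treeSizeProb μ (n + 1)) :=
        le_mul_of_one_le_right (by positivity) hlow'
      _ = B * ((n + 1 : ℕ) : ℝ) ^ (K + 4) * treeSizeProb μ (n + 1) := by ring
      _ ≤ B * (2 * n) ^ (K + 4) * treeSizeProb μ (n + 1) := by gcongr
      _ = _ := by rw [mul_pow]; ring
  have hn4 : (0 : ℝ) < (n : ℝ) ^ (K + 4) := by positivity
  rw [← mul_assoc, mul_right_comm _ ((n : ℝ) ^ (K + 4)) (treeSizeProb μ (n + 1))] at hfinal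
  have := le_of_mul_le_mul_right hfinal hn4
  rw [mul_assoc (B * 2 ^ (K + 4)), mul_comm (((n : ℝ) ^ c)⁻¹), ← mul_assoc, ← div_eq_mul_inv,
    le_div_iff₀ hcpos]
  exact this

end
end
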